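/- Improved decay of the negative part under a one-sided C^{1/2} condition in time (estimate (4.2) in the proof of Theorem 1.3): Let α∈(0,1] and K>0. There exist constants β>1, C₀>0, c>0 and r₀∈(0,1) depending only on n, α and K such that the following holds for every 0<r≤r₀, with f(r)=exp(C₀ r^{β(1−1/α)}). Assume [g]_{C^{α,α/(1+α)}} ≤ K and additionally g(x',t+s)−g(x',t) ≥ −K s^{1/2} for all x' and all s ≥ 0. Let w be a solution of the heat equation ∂_t w = Δw in 𝒞_r^− whose negative part w⁻ vanishes continuously on Γ. If w ≥ f(r) on 𝒜_r and w ≥ −1 on 𝒞_r^−, then w⁻ ≤ exp(−c r^{1−β/α}) on 𝒞_{r/2}^−. -/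

import Mathlib

noncomputable section
open scoped BigOperators
open Classical

abbrev Spc (m : ℕ) := EuclideanSpace ℝ (Fin (m + 1))
abbrev Spc' (m : ℕ) := EuclideanSpace ℝ (Fin m)

/-- The horizontal coordinates `x' ∈ ℝ^{n-1}` of a point `x ∈ ℝⁿ`. -/
def xprime {m : ℕ} (x : Spc m) : Spc' m :=
  (WithLp.equiv 2 _).symm fun i => x i.castSucc

/-- The last (vertical) coordinate `x_n` of a point `x ∈ ℝⁿ`. -/
def xlast {m : ℕ} (x : Spc m) : ℝ := x (Fin.last m)

/-- Build a point of `ℝⁿ` from `x' ∈ ℝ^{n-1}` and the vertical coordinate. -/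
def mkPt {m : ℕ} (x' : Spc' m) (xn : ℝ) : Spc m :=
  (WithLp.equiv 2 _).symm fun i => if h : i = Fin.last m then xn else x' (i.castPred h)

/-- The `i`-th standard basis vector. -/
def eVec (m : ℕ) (i : Fin (m + 1)) : Spc m := EuclideanSpace.single i 1

/-- The entry `∂²u/∂xᵢ∂xⱼ` of the spatial Hessian of `u(x,t)` at `p = (x,t)`. -/
def sHess {m : ℕ} (u : Spc m × ℝ → ℝ) (p : Spc m × ℝ) (i j : Fin (m + 1)) : ℝ :=
  fderiv ℝ (fun y => fderiv ℝ (fun z => u (z, p.2)) y (eVec m j)) p.1 (eVec m i)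

/-- The operator `Lu = tr(A(x) D²ₓu)` at the point `p = (x,t)`. -/
def Lop {m : ℕ} (A : Spc m → Matrix (Fin (m + 1)) (Fin (m + 1)) ℝ)
    (u : Spc m × ℝ → ℝ) (p : Spc m × ℝ) : ℝ :=
  ∑ i, ∑ j, A p.1 i j * sHess u p j i

/-- Uniform ellipticity with symmetric coefficients: `λ|ξ|² ≤ ξ·A(x)ξ ≤ Λ|ξ|²`. -/
def IsElliptic {m : ℕ} (lam Lam : ℝ)
    (A : Spc m → Matrix (Fin (m + 1)) (Fin (m + 1)) ℝ) : Prop :=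
  (∀ x, (A x).IsSymm) ∧
  ∀ (x ξ : Spc m),
    lam * ‖ξ‖ ^ 2 ≤ ∑ i, ∑ j, ξ i * A x i j * ξ j ∧
      ∑ i, ∑ j, ξ i * A x i j * ξ j ≤ Lam * ‖ξ‖ ^ 2

/-- `u` is (pointwise) a solution of `u_t = Lu` on `Ω`: twice continuously
differentiable in `x`, differentiable in `t`, with `∂ₜu = tr(A(x)D²ₓu)`. -/
def SolvesL {m : ℕ} (A : Spc m → Matrix (Fin (m + 1)) (Fin (m + 1)) ℝ)
    (u : Spc m × ℝ → ℝ) (Ω : Set (Spc m × ℝ)) : Prop :=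
  ∀ p ∈ Ω, ContDiffAt ℝ 2 (fun y => u (y, p.2)) p.1 ∧
    HasDerivAt (fun s => u (p.1, s)) (Lop A u p) p.2

/-- `u` is a pointwise subsolution: `u_t ≤ Lu` on `Ω`. -/
def SubSolvesL {m : ℕ} (A : Spc m → Matrix (Fin (m + 1)) (Fin (m + 1)) ℝ)
    (u : Spc m × ℝ → ℝ) (Ω : Set (Spc m × ℝ)) : Prop :=
  ∀ p ∈ Ω, ContDiffAt ℝ 2 (fun y => u (y, p.2)) p.1 ∧
    DifferentiableAt ℝ (fun s => u (p.1, s)) p.2 ∧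
    deriv (fun s => u (p.1, s)) p.2 ≤ Lop A u p

/-- `u` solves the heat equation `∂ₜu = Δu` on `Ω`. -/
def SolvesHeat {m : ℕ} (u : Spc m × ℝ → ℝ) (Ω : Set (Spc m × ℝ)) : Prop :=
  ∀ p ∈ Ω, ContDiffAt ℝ 2 (fun y => u (y, p.2)) p.1 ∧
    HasDerivAt (fun s => u (p.1, s)) (∑ i, sHess u p i i) p.2

/-- The graph `Γ = {x_n = g(x',t)}`. -/
def graphSet {m : ℕ} (g : Spc' m → ℝ → ℝ) : Set (Spc m × ℝ) :=
  {p | xlast p.1 = g (xprime p.1) p.2}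

/-- The cylinder `𝒞_r` of size `r` on top of the graph of `g`. -/
def Cyl {m : ℕ} (g : Spc' m → ℝ → ℝ) (r : ℝ) : Set (Spc m × ℝ) :=
  {p | ‖xprime p.1‖ < r ∧ -r ^ 2 < p.2 ∧ p.2 < r ^ 2 ∧
    g (xprime p.1) p.2 < xlast p.1 ∧ xlast p.1 < g (xprime p.1) p.2 + r}

/-- The point `Ē = ((0', g(0',1/2) + 1/2), 1/2)`. -/
def Ebar {m : ℕ} (g : Spc' m → ℝ → ℝ) : Spc m × ℝ := (mkPt 0 (g 0 (1 / 2) + 1 / 2), 1 / 2)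

/-- The point `E̲ = ((0', g(0',−1/2) + 1/2), −1/2)`. -/
def Eund {m : ℕ} (g : Spc' m → ℝ → ℝ) : Spc m × ℝ := (mkPt 0 (g 0 (-(1 / 2)) + 1 / 2), -(1 / 2))

/-- `u` vanishes continuously on `Γ`: `u(Q) → 0` as `Q → P` within `Ω`,
for every `P ∈ Γ` in the closure of `Ω`. -/
def VanishesOn {m : ℕ} (u : Spc m × ℝ → ℝ) (Ω Γ : Set (Spc m × ℝ)) : Prop :=
  ∀ P ∈ Γ ∩ closure Ω, Filter.Tendsto u (nhdsWithin P Ω) (nhds 0)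

/-- `[g]_{C^{α,β}} ≤ K`. -/
def HolderSemi {m : ℕ} (α β K : ℝ) (g : Spc' m → ℝ → ℝ) : Prop :=
  ∀ x' y' t s, |g x' t - g y' s| ≤ K * (‖x' - y'‖ ^ α + |t - s| ^ β)

/-- The backward-in-time cylinder `𝒞_r^−` (Lipschitz setting, parabolic scaling). -/
def CylB {m : ℕ} (g : Spc' m → ℝ → ℝ) (r : ℝ) : Set (Spc m × ℝ) :=
  {p | (∀ i : Fin m, -r < xprime p.1 i ∧ xprime p.1 i < r) ∧ -r ^ 2 < p.2 ∧ p.2 ≤ 0 ∧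
    g (xprime p.1) p.2 < xlast p.1 ∧ xlast p.1 < g (xprime p.1) p.2 + r}

/-- The set `𝒜_r` of points of `𝒞_r^−` at height at least `δr` above `Γ`. -/
def ASet {m : ℕ} (g : Spc' m → ℝ → ℝ) (δ r : ℝ) : Set (Spc m × ℝ) :=
  {p ∈ CylB g r | g (xprime p.1) p.2 + δ * r ≤ xlast p.1}

/-- The backward-in-time cylinder `𝒞_r^−` (Hölder setting, time interval `(−r,0]`). -/
def CylBH {m : ℕ} (g : Spc' m → ℝ → ℝ) (r : ℝ) : Set (Spc m × ℝ) :=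
  {p | (∀ i : Fin m, -r < xprime p.1 i ∧ xprime p.1 i < r) ∧ -r < p.2 ∧ p.2 ≤ 0 ∧
    g (xprime p.1) p.2 < xlast p.1 ∧ xlast p.1 < g (xprime p.1) p.2 + r}

/-- The set `𝒜_r` of points of the Hölder cylinder `𝒞_r^−` at height at least `r^β` above `Γ`. -/
def ASetH {m : ℕ} (g : Spc' m → ℝ → ℝ) (β r : ℝ) : Set (Spc m × ℝ) :=
  {p ∈ CylBH g r | g (xprime p.1) p.2 + r ^ β ≤ xlast p.1}

/-- The height `h_Γ(x,t) = x_n − g(x',t)` above the graph. -/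
def hGamma {m : ℕ} (g : Spc' m → ℝ → ℝ) (p : Spc m × ℝ) : ℝ :=
  xlast p.1 - g (xprime p.1) p.2

section NegativePart

open Filter Topology Set MeasureTheory

/-- The second derivative of `φ` in the `i`-th coordinate direction at `x` exists and equals `a`. -/
def HasSnd {m : ℕ} (φ : Spc m → ℝ) (x : Spc m) (i : Fin (m + 1)) (a : ℝ) : Prop :=
  ∃ φ' : ℝ → ℝ, (∀ᶠ s in 𝓝 (0 : ℝ), HasDerivAt (fun s : ℝ => φ (x + s • eVec m i)) (φ' s) s) ∧
    HasDerivAt φ' a 0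

/-- The pure second coordinate derivatives of `φ` at `x` exist and sum to `a`. -/
def HasLap {m : ℕ} (φ : Spc m → ℝ) (x : Spc m) (a : ℝ) : Prop :=
  ∃ A : Fin (m + 1) → ℝ, (∀ i, HasSnd φ x i (A i)) ∧ ∑ i, A i = a

section Laplacian

variable {m : ℕ} {φ ψ : Spc m → ℝ} {x : Spc m} {i : Fin (m + 1)} {a b : ℝ}

lemma HasSnd.add (h : HasSnd φ x i a) (h' : HasSnd ψ x i b) :
    HasSnd (fun y => φ y + ψ y) x i (a + b) := by
  obtain ⟨f, hf, hf'⟩ := h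
  obtain ⟨k, hk, hk'⟩ := h'
  refine ⟨fun s => f s + k s, ?_, hf'.add hk'⟩
  filter_upwards [hf, hk] with s h1 h2 using h1.add h2

lemma HasSnd.const_mul (c : ℝ) (h : HasSnd φ x i a) : HasSnd (fun y => c * φ y) x i (c * a) := by
  obtain ⟨f, hf, hf'⟩ := h
  refine ⟨fun s => c * f s, ?_, hf'.const_mul c⟩
  filter_upwards [hf] with s h1 using h1.const_mul c

lemma hasSnd_const (c : ℝ) : HasSnd (fun _ : Spc m => c) x i 0 :=
  ⟨fun _ => 0, Eventually.of_forall fun s => hasDerivAt_const s c, hasDerivAt_const 0 0⟩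

lemma tendsto_line (x : Spc m) (i : Fin (m + 1)) :
    Tendsto (fun s : ℝ => x + s • eVec m i) (𝓝 0) (𝓝 x) := by
  have : Continuous fun s : ℝ => x + s • eVec m i := by fun_prop
  simpa using this.tendsto 0

lemma HasSnd.congr (h : HasSnd φ x i a) (he : ψ =ᶠ[𝓝 x] φ) : HasSnd ψ x i a := by
  obtain ⟨f, hf, hf'⟩ := h
  refine ⟨f, ?_, hf'⟩
  have h2 := ((tendsto_line x i).eventually he).eventually_nhds
  filter_upwards [hf, h2] with s h1 h2 using h1.congr_of_eventuallyEq h2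

lemma HasSnd.translate (v : Spc m) (h : HasSnd φ (x + v) i a) :
    HasSnd (fun y => φ (y + v)) x i a := by
  obtain ⟨f, hf, hf'⟩ := h
  refine ⟨f, ?_, hf'⟩
  have : (fun s : ℝ => φ (x + s • eVec m i + v)) = fun s : ℝ => φ (x + v + s • eVec m i) := by
    funext s; congr 1; abel
  simpa only [this] using hf

lemma HasSnd.nonneg_of_isLocalMin (h : HasSnd φ x i a) (hmin : IsLocalMin φ x) : 0 ≤ a := by
  obtain ⟨f, hf, hf'⟩ := h
  by_contra! ha
  set F : ℝ → ℝ := fun s => φ (x + s • eVec m i) - a / 4 * s ^ 2 with hF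
  have hFd : ∀ᶠ s in 𝓝 (0 : ℝ), HasDerivAt F (f s - a / 2 * s) s := by
    filter_upwards [hf] with s hs
    have := hs.sub (((hasDerivAt_id s).pow 2).const_mul (a / 4))
    refine this.congr_deriv ?_
    simp; ring
  have hmin0 : IsLocalMin (fun s : ℝ => φ (x + s • eVec m i)) 0 := by
    have := (tendsto_line x i).eventually hmin
    filter_upwards [this] with s hs
    simpa using hs
  have hf0 : f 0 = 0 := hmin0.hasDerivAt_eq_zero hf.self_of_nhds
  have hdd : deriv F =ᶠ[𝓝 0] fun s => f s - a / 2 * s := by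
    filter_upwards [hFd] with s hs using hs.deriv
  have hmax : IsLocalMax F 0 := by
    apply isLocalMax_of_deriv_deriv_neg
    · rw [hdd.deriv_eq]
      have : HasDerivAt (fun s => f s - a / 2 * s) (a - a / 2 * 1) 0 :=
        hf'.sub ((hasDerivAt_id (0 : ℝ)).const_mul (a / 2))
      rw [this.deriv]; linarith
    · rw [hFd.self_of_nhds.deriv, hf0]; simp
    · exact hFd.self_of_nhds.continuousAt
  have : ∀ᶠ s in 𝓝[≠] (0 : ℝ), False := by
    filter_upwards [hmax.filter_mono nhdsWithin_le_nhds, hmin0.filter_mono nhdsWithin_le_nhds,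
      self_mem_nhdsWithin] with s h1 h2 h3
    simp only [hF] at h1
    simp only [zero_smul, add_zero] at h1 h2
    have : 0 < s ^ 2 := sq_pos_of_ne_zero h3
    nlinarith
  exact this.exists.elim fun _ h => h

lemma HasLap.add (h : HasLap φ x a) (h' : HasLap ψ x b) :
    HasLap (fun y => φ y + ψ y) x (a + b) := by
  obtain ⟨A, hA, rfl⟩ := h
  obtain ⟨B, hB, rfl⟩ := h'
  exact ⟨fun i => A i + B i, fun i => (hA i).add (hB i), Finset.sum_add_distrib⟩

lemma HasLap.const_mul (c : ℝ) (h : HasLap φ x a) : HasLap (fun y => c * φ y) x (c * a) := by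
  obtain ⟨A, hA, rfl⟩ := h
  exact ⟨fun i => c * A i, fun i => (hA i).const_mul c, by rw [Finset.mul_sum]⟩

lemma hasLap_const (c : ℝ) : HasLap (fun _ : Spc m => c) x 0 :=
  ⟨fun _ => 0, fun _ => hasSnd_const c, by simp⟩

lemma HasLap.congr (h : HasLap φ x a) (he : ψ =ᶠ[𝓝 x] φ) : HasLap ψ x a := by
  obtain ⟨A, hA, rfl⟩ := h
  exact ⟨A, fun i => (hA i).congr he, rfl⟩

lemma HasLap.translate (v : Spc m) (h : HasLap φ (x + v) a) :
    HasLap (fun y => φ (y + v)) x a := by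
  obtain ⟨A, hA, rfl⟩ := h
  exact ⟨A, fun i => (hA i).translate v, rfl⟩

lemma HasLap.nonneg_of_isLocalMin (h : HasLap φ x a) (hmin : IsLocalMin φ x) : 0 ≤ a := by
  obtain ⟨A, hA, rfl⟩ := h
  exact Finset.sum_nonneg fun i _ => (hA i).nonneg_of_isLocalMin hmin

lemma hasLap_of_contDiffAt (u : Spc m × ℝ → ℝ) (p : Spc m × ℝ)
    (h : ContDiffAt ℝ 2 (fun y => u (y, p.2)) p.1) :
    HasLap (fun y => u (y, p.2)) p.1 (∑ i, sHess u p i i) := by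
  refine ⟨fun i => sHess u p i i, fun i => ?_, rfl⟩
  refine ⟨fun s => fderiv ℝ (fun z => u (z, p.2)) (p.1 + s • eVec m i) (eVec m i), ?_, ?_⟩
  · have h1 : ∀ᶠ y in 𝓝 p.1, DifferentiableAt ℝ (fun y => u (y, p.2)) y := by
      filter_upwards [h.eventually (by simp)] with y hy
      exact hy.differentiableAt (by norm_num)
    filter_upwards [(tendsto_line p.1 i).eventually h1] with s hs
    have h2 : HasDerivAt (fun s : ℝ => p.1 + s • eVec m i) (eVec m i) s := by
      simpa using ((hasDerivAt_id s).smul_const (eVec m i)).const_add p.1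
    exact hs.hasFDerivAt.comp_hasDerivAt s h2
  · have h2 : HasDerivAt (fun s : ℝ => p.1 + s • eVec m i) (eVec m i) 0 := by
      simpa using ((hasDerivAt_id (0:ℝ)).smul_const (eVec m i)).const_add p.1
    have h3 : DifferentiableAt ℝ (fun y => fderiv ℝ (fun z => u (z, p.2)) y (eVec m i)) p.1 := by
      have : ContDiffAt ℝ 1 (fderiv ℝ (fun z => u (z, p.2))) p.1 :=
        h.fderiv_right (by norm_num)
      exact (this.differentiableAt (by norm_num)).clm_apply (differentiableAt_const _)
    have h4 : HasFDerivAt (fun y => fderiv ℝ (fun z => u (z, p.2)) y (eVec m i))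
        (fderiv ℝ (fun y => fderiv ℝ (fun z => u (z, p.2)) y (eVec m i)) p.1)
        (p.1 + (0:ℝ) • eVec m i) := by
      simpa using h3.hasFDerivAt
    exact h4.comp_hasDerivAt (0:ℝ) h2

lemma inner_eVec (x : Spc m) (i : Fin (m + 1)) : inner ℝ x (eVec m i) = x i := by
  simp [eVec, EuclideanSpace.inner_single_right]

lemma norm_eVec (i : Fin (m + 1)) : ‖eVec m i‖ = 1 := by simp [eVec]

lemma norm_line_sq (x x0 : Spc m) (i : Fin (m + 1)) (s : ℝ) :
    ‖x + s • eVec m i - x0‖ ^ 2 = ‖x - x0‖ ^ 2 + 2 * s * (x i - x0 i) + s ^ 2 := by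
  have : x + s • eVec m i - x0 = (x - x0) + s • eVec m i := by abel
  rw [this, norm_add_sq_real, inner_smul_right, inner_eVec, norm_smul, norm_eVec]
  simp; ring

lemma hasLap_norm_sq (x0 : Spc m) : HasLap (fun y => ‖y - x0‖ ^ 2) x (2 * (m + 1)) := by
  refine ⟨fun _ => 2, fun i => ⟨fun s => 2 * (x i - x0 i) + 2 * s, ?_, ?_⟩, ?_⟩
  · refine Eventually.of_forall fun s => ?_
    simp only [norm_line_sq]
    have := (((hasDerivAt_id s).const_mul 2).mul_const (x i - x0 i)).const_add (‖x - x0‖ ^ 2)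
      |>.add ((hasDerivAt_id s).pow 2)
    refine this.congr_deriv ?_
    simp
  · simpa using ((hasDerivAt_id (0:ℝ)).const_mul 2).const_add (2 * (x i - x0 i))
  · simp; ring

end Laplacian

/-- `Ψ` solves the heat equation at `p` in the weak pointwise sense used for comparison: the pure
second space derivatives exist, and the left time derivative equals their sum. -/
def HasHeat {m : ℕ} (Ψ : Spc m × ℝ → ℝ) (p : Spc m × ℝ) : Prop :=
  ∃ D, HasLap (fun z => Ψ (z, p.2)) p.1 D ∧
    HasDerivWithinAt (fun s => Ψ (p.1, s)) D (Iic p.2) p.2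

section HasHeat

variable {m : ℕ} {Ψ Φ : Spc m × ℝ → ℝ} {p : Spc m × ℝ}

lemma HasHeat.add (h : HasHeat Ψ p) (h' : HasHeat Φ p) : HasHeat (fun q => Ψ q + Φ q) p := by
  obtain ⟨D, h1, h2⟩ := h
  obtain ⟨D', h1', h2'⟩ := h'
  exact ⟨D + D', h1.add h1', h2.add h2'⟩

lemma HasHeat.const_mul (c : ℝ) (h : HasHeat Ψ p) : HasHeat (fun q => c * Ψ q) p := by
  obtain ⟨D, h1, h2⟩ := h
  exact ⟨c * D, h1.const_mul c, h2.const_mul c⟩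

lemma hasHeat_const (c : ℝ) : HasHeat (fun _ => c) p :=
  ⟨0, hasLap_const c, hasDerivWithinAt_const _ _ _⟩

lemma HasHeat.congr (h : HasHeat Φ p)
    (hx : ∀ᶠ z in 𝓝 p.1, Ψ (z, p.2) = Φ (z, p.2))
    (ht : ∀ᶠ s in 𝓝[≤] p.2, Ψ (p.1, s) = Φ (p.1, s)) : HasHeat Ψ p := by
  obtain ⟨D, h1, h2⟩ := h
  exact ⟨D, h1.congr hx, h2.congr_of_eventuallyEq ht hx.self_of_nhds⟩

lemma HasHeat.translate (v : Spc m × ℝ) (h : HasHeat Ψ (p + v)) :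
    HasHeat (fun q => Ψ (q + v)) p := by
  obtain ⟨D, h1, h2⟩ := h
  refine ⟨D, h1.translate v.1, ?_⟩
  have h3 : HasDerivWithinAt (fun s => s + v.2) 1 (Iic p.2) p.2 :=
    (hasDerivWithinAt_id _ _).add_const _
  have := HasDerivWithinAt.scomp p.2 (t' := Iic (p + v).2) (g₁ := fun s => Ψ ((p + v).1, s))
    (h := fun s => s + v.2) h2 h3 fun s (hs : s ≤ p.2) => add_le_add_left hs v.2
  rw [one_smul] at this
  exact this

lemma SolvesHeat.hasHeat {Ω : Set (Spc m × ℝ)} (h : SolvesHeat Ψ Ω) (hp : p ∈ Ω) :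
    HasHeat Ψ p :=
  ⟨_, hasLap_of_contDiffAt Ψ p (h p hp).1, (h p hp).2.hasDerivWithinAt⟩

end HasHeat

/-- Minimum principle for supersolutions of the heat equation in a cylinder, needing only lower
semicontinuity forward in time at the negative values. -/
theorem minimum_principle {m : ℕ} (Ψ : Spc m × ℝ → ℝ) (x0 : Spc m) (R a b : ℝ)
    (hinit : ∀ y ∈ Metric.closedBall x0 R, 0 ≤ Ψ (y, a))
    (hlat : ∀ y t, ‖y - x0‖ = R → t ∈ Icc a b → 0 ≤ Ψ (y, t))
    (hlsc : ∀ p ∈ Metric.closedBall x0 R ×ˢ Icc a b, ∀ c < 0, c < Ψ p →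
      ∀ᶠ q in 𝓝[{q | q ∈ Metric.closedBall x0 R ×ˢ Icc a b ∧ p.2 ≤ q.2}] p, c < Ψ q)
    (hpde : ∀ y t, ‖y - x0‖ < R → a < t → t ≤ b → Ψ (y, t) < 0 → HasHeat Ψ (y, t)) :
    ∀ p ∈ Metric.closedBall x0 R ×ˢ Icc a b, 0 ≤ Ψ p := by
  rintro ⟨y0, t0⟩ ⟨hy0, ht0⟩
  by_contra! hneg
  simp only at hy0 ht0
  have hat0 : a < t0 := lt_of_le_of_ne ht0.1 fun h => by
    subst h; exact absurd (hinit y0 hy0) (not_le.2 hneg)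
  obtain ⟨ε, hε, hκ⟩ : ∃ ε > 0, Ψ (y0, t0) + ε * (t0 - a) < 0 := by
    refine ⟨-Ψ (y0, t0) / (2 * (t0 - a)), div_pos (by linarith) (by linarith), ?_⟩
    have : t0 - a ≠ 0 := by linarith
    field_simp; linarith
  set κ := -(Ψ (y0, t0) + ε * (t0 - a)) with hκd
  have hκ0 : 0 < κ := by linarith
  set S := {t | t ∈ Icc a t0 ∧ ∃ y ∈ Metric.closedBall x0 R, Ψ (y, t) + ε * (t - a) ≤ -κ} with hS
  have hSt0 : t0 ∈ S := ⟨⟨hat0.le, le_rfl⟩, y0, hy0, by linarith⟩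
  have hSb : BddBelow S := ⟨a, fun t ht => ht.1.1⟩
  obtain ⟨u, -, hu, huS⟩ := exists_seq_tendsto_sInf ⟨t0, hSt0⟩ hSb
  set T := sInf S with hT
  have hTle : ∀ t ∈ S, T ≤ t := fun t ht => csInf_le hSb ht
  have haT : a ≤ T := le_csInf ⟨t0, hSt0⟩ fun t ht => ht.1.1
  have hTt0 : T ≤ t0 := hTle t0 hSt0
  have hTS : ∃ y ∈ Metric.closedBall x0 R, Ψ (y, T) + ε * (T - a) ≤ -κ := by
    choose y hyb hyΨ using fun k => (huS k).2
    obtain ⟨y', hy', k, hk, hlim⟩ := (isCompact_closedBall x0 R).tendsto_subseq hyb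
    refine ⟨y', hy', ?_⟩
    by_contra! hgt
    have hεT : 0 ≤ ε * (T - a) := mul_nonneg hε.le (by linarith)
    obtain ⟨c, hc1, hc2⟩ := exists_between (show -κ - ε * (T - a) < min 0 (Ψ (y', T)) from
      lt_min (by linarith) (by linarith))
    have hev := hlsc (y', T) ⟨hy', haT, hTt0.trans ht0.2⟩ c (hc2.trans_le (min_le_left _ _))
      (hc2.trans_le (min_le_right _ _))
    have htend : Tendsto (fun j => (y (k j), u (k j))) atTop
        (𝓝[{q | q ∈ Metric.closedBall x0 R ×ˢ Icc a b ∧ (y', T).2 ≤ q.2}] (y', T)) := by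
      refine tendsto_nhdsWithin_iff.2 ⟨hlim.prodMk_nhds (hu.comp hk.tendsto_atTop), ?_⟩
      refine Eventually.of_forall fun j => ⟨⟨hyb _, (huS _).1.1, (huS _).1.2.trans ht0.2⟩, ?_⟩
      exact hTle _ (huS _)
    obtain ⟨j, hj⟩ := (htend.eventually hev).exists
    have h1 := hyΨ (k j)
    have h2 := hTle _ (huS (k j))
    nlinarith
  obtain ⟨ys, hys, hysΨ⟩ := hTS
  have hεT : 0 ≤ ε * (T - a) := mul_nonneg hε.le (by linarith)
  have hTI : T ∈ Icc a b := ⟨haT, hTt0.trans ht0.2⟩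
  have hsl : LowerSemicontinuousOn (fun y => min (Ψ (y, T)) 0) (Metric.closedBall x0 R) := by
    intro y hy c hc
    have hc' := lt_min_iff.1 hc
    have hev := hlsc (y, T) ⟨hy, hTI⟩ c hc'.2 hc'.1
    have htend : Tendsto (fun z : Spc m => (z, T)) (𝓝[Metric.closedBall x0 R] y)
        (𝓝[{q | q ∈ Metric.closedBall x0 R ×ˢ Icc a b ∧ (y, T).2 ≤ q.2}] (y, T)) := by
      refine tendsto_nhdsWithin_iff.2 ⟨?_, ?_⟩
      · have : Continuous fun z : Spc m => (z, T) := by fun_prop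
        exact (this.tendsto y).mono_left nhdsWithin_le_nhds
      · filter_upwards [self_mem_nhdsWithin] with z hz
        exact ⟨⟨hz, hTI⟩, le_rfl⟩
    filter_upwards [htend.eventually hev] with z hz
    exact lt_min hz hc'.2
  obtain ⟨y1, hy1, hmin⟩ := hsl.exists_isMinOn ⟨ys, hys⟩ (isCompact_closedBall x0 R)
  have h1 : min (Ψ (y1, T)) 0 ≤ Ψ (ys, T) := (hmin hys).trans (min_le_left _ _)
  have h2 : min (Ψ (y1, T)) 0 = Ψ (y1, T) := by
    rcases le_total (Ψ (y1, T)) 0 with h | h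
    · exact min_eq_left h
    · rw [min_eq_right h] at h1; linarith
  rw [h2] at h1
  have hneg1 : Ψ (y1, T) < 0 := by linarith
  have hint : ‖y1 - x0‖ < R := by
    refine lt_of_le_of_ne (by simpa [dist_eq_norm] using hy1) fun h => ?_
    exact absurd (hlat y1 T h hTI) (not_le.2 hneg1)
  have haT' : a < T := lt_of_le_of_ne haT fun h => by
    rw [← h] at hneg1; exact absurd (hinit y1 hy1) (not_le.2 hneg1)
  obtain ⟨d, hA, hd⟩ := hpde y1 T hint haT' hTI.2 hneg1
  have hlm : IsLocalMin (fun z => Ψ (z, T)) y1 := by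
    have : Metric.ball x0 R ∈ 𝓝 y1 := Metric.isOpen_ball.mem_nhds (by simpa [dist_eq_norm])
    filter_upwards [this] with z hz
    have := hmin (Metric.ball_subset_closedBall hz)
    exact h2.symm.le.trans (this.trans (min_le_left _ _))
  have hA0 : 0 ≤ d := hA.nonneg_of_isLocalMin hlm
  have hd' : HasDerivWithinAt (fun s => Ψ (y1, s) + ε * (s - a)) (d + ε) (Iic T) T := by
    have := ((hasDerivWithinAt_id T (Iic T)).sub_const a).const_mul ε
    rw [mul_one] at this
    exact hd.add this
  have hd2 := hasDerivWithinAt_iff_tendsto_slope.1 hd'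
  have hset : Iic T \ {T} = Iio T := by ext s; simp [lt_iff_le_and_ne]
  rw [hset] at hd2
  have e1 := hd2.eventually (lt_mem_nhds (show 0 < d + ε by linarith))
  have e2 : ∀ᶠ s in 𝓝[<] T, a < s := nhdsWithin_le_nhds (lt_mem_nhds haT')
  obtain ⟨s, ⟨hs1, hs2⟩, hs3⟩ := ((e1.and e2).and self_mem_nhdsWithin).exists
  replace hs3 : s < T := hs3
  rw [slope_def_field] at hs1
  have hs4 : Ψ (y1, s) + ε * (s - a) - (Ψ (y1, T) + ε * (T - a)) < 0 := by
    by_contra! hcon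
    have := div_nonpos_of_nonneg_of_nonpos hcon (show s - T ≤ 0 by linarith)
    linarith
  have hsS : s ∈ S := ⟨⟨hs2.le, hs3.le.trans hTt0⟩, y1, hy1, by linarith⟩
  linarith [hTle s hsS]

lemma hasDerivAt_integral_compactSupport {m : ℕ} {θ : Spc m → ℝ} (hθ : Continuous θ)
    (hθc : HasCompactSupport θ) {F F' : ℝ → Spc m → ℝ} {s₀ δ : ℝ} (hδ : 0 < δ)
    (hF : ∀ s ∈ Metric.closedBall s₀ δ, Continuous (F s))
    (hF' : ContinuousOn (fun q : ℝ × Spc m => F' q.1 q.2) (Metric.closedBall s₀ δ ×ˢ univ))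
    (hd : ∀ s ∈ Metric.closedBall s₀ δ, ∀ z, HasDerivAt (fun s => F s z) (F' s z) s) :
    HasDerivAt (fun s => ∫ z, θ z * F s z) (∫ z, θ z * F' s₀ z) s₀ := by
  have hs₀ : s₀ ∈ Metric.closedBall s₀ δ := Metric.mem_closedBall_self hδ.le
  have hK : IsCompact (Metric.closedBall s₀ δ ×ˢ tsupport θ) :=
    (isCompact_closedBall s₀ δ).prod hθc
  obtain ⟨C, hC⟩ := hK.exists_bound_of_continuousOn
    (f := fun q : ℝ × Spc m => θ q.2 * F' q.1 q.2)
    ((hθ.comp continuous_snd).continuousOn.mul (hF'.mono (prod_mono_right (subset_univ _))))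
  have hcs : ∀ s ∈ Metric.closedBall s₀ δ, Continuous (F' s) := fun s hs => by
    rw [← continuousOn_univ]
    exact hF'.comp (by fun_prop : Continuous fun z : Spc m => (s, z)).continuousOn
      fun z _ => ⟨hs, mem_univ _⟩
  refine (hasDerivAt_integral_of_dominated_loc_of_deriv_le (μ := volume)
    (F := fun s z => θ z * F s z) (F' := fun s z => θ z * F' s z)
    (bound := (tsupport θ).indicator fun _ => C) (Metric.closedBall_mem_nhds s₀ hδ)
    ?_ ?_ ?_ ?_ ?_ ?_).2
  · filter_upwards [Metric.closedBall_mem_nhds s₀ hδ] with s hs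
    exact (hθ.mul (hF s hs)).aestronglyMeasurable
  · exact (hθ.mul (hF s₀ hs₀)).integrable_of_hasCompactSupport hθc.mul_right
  · exact (hθ.mul (hcs s₀ hs₀)).aestronglyMeasurable
  · refine Eventually.of_forall fun z s hs => ?_
    by_cases hz : z ∈ tsupport θ
    · rw [indicator_of_mem hz]; exact hC (s, z) ⟨hs, hz⟩
    · rw [indicator_of_notMem hz, image_eq_zero_of_notMem_tsupport hz]; simp
  · exact (integrable_indicator_iff (isClosed_tsupport θ).measurableSet).2
      (integrableOn_const hθc.measure_lt_top.ne)
  · exact Eventually.of_forall fun z s hs => (hd s hs z).const_mul (θ z)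

/-- The unnormalized heat kernel on `ℝⁿ`, `n = m + 1`. -/
def heatKer (m : ℕ) (t v : ℝ) : ℝ := Real.exp (-v / (4 * t) - (m + 1) / 2 * Real.log t)

/-- The total mass of the Gaussian `exp(-|u|²/4)`. -/
def gaussMass (m : ℕ) : ℝ := ∫ u : Spc m, Real.exp (-‖u‖ ^ 2 / 4)

lemma integrable_gauss (m : ℕ) : Integrable fun u : Spc m => Real.exp (-‖u‖ ^ 2 / 4) := by
  have h := (GaussianFourier.integrable_cexp_neg_mul_sq_norm_add (V := Spc m)
    (b := (1 / 4 : ℂ)) (by norm_num) 0 0).norm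
  refine h.congr (Eventually.of_forall fun u => ?_)
  simp only [Complex.norm_exp]
  congr 1
  have : (-(1 / 4 : ℂ) * (‖u‖ : ℂ) ^ 2 + 0 * (inner ℝ (0 : Spc m) u : ℝ)) =
    ((-‖u‖ ^ 2 / 4 : ℝ) : ℂ) := by push_cast; ring
  rw [this, Complex.ofReal_re]

lemma gaussMass_pos (m : ℕ) : 0 < gaussMass m := integral_exp_pos (integrable_gauss m)

/-- The heat extension of the initial datum `θ`. -/
def heatExt {m : ℕ} (θ : Spc m → ℝ) (p : Spc m × ℝ) : ℝ :=
  (gaussMass m)⁻¹ * ∫ u : Spc m, θ (p.1 - √p.2 • u) * Real.exp (-‖u‖ ^ 2 / 4)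

section HeatExt

variable {m : ℕ} {θ : Spc m → ℝ}

lemma integrable_heatExt (hθ : Continuous θ) (h0 : ∀ z, 0 ≤ θ z) (h1 : ∀ z, θ z ≤ 1)
    (p : Spc m × ℝ) :
    Integrable fun u : Spc m => θ (p.1 - √p.2 • u) * Real.exp (-‖u‖ ^ 2 / 4) := by
  refine (integrable_gauss m).mono' (by fun_prop) (Eventually.of_forall fun u => ?_)
  rw [Real.norm_of_nonneg (mul_nonneg (h0 _) (Real.exp_pos _).le)]
  exact mul_le_of_le_one_left (Real.exp_pos _).le (h1 _)

lemma continuous_heatExt (hθ : Continuous θ) (h0 : ∀ z, 0 ≤ θ z) (h1 : ∀ z, θ z ≤ 1) :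
    Continuous (heatExt θ) := by
  unfold heatExt
  refine continuous_const.mul (continuous_of_dominated
    (bound := fun u : Spc m => Real.exp (-‖u‖ ^ 2 / 4)) ?_ ?_ (integrable_gauss m) ?_)
  · intro p
    exact (integrable_heatExt hθ h0 h1 p).aestronglyMeasurable
  · refine fun p => Eventually.of_forall fun u => ?_
    rw [Real.norm_of_nonneg (mul_nonneg (h0 _) (Real.exp_pos _).le)]
    exact mul_le_of_le_one_left (Real.exp_pos _).le (h1 _)
  · refine Eventually.of_forall fun u => ?_
    fun_prop

lemma heatExt_zero (y : Spc m) : heatExt θ (y, 0) = θ y := by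
  simp only [heatExt, Real.sqrt_zero, zero_smul, sub_zero]
  rw [integral_const_mul]
  change (gaussMass m)⁻¹ * (θ y * gaussMass m) = _
  field_simp [(gaussMass_pos m).ne']

lemma heatExt_nonneg (h0 : ∀ z, 0 ≤ θ z) (p : Spc m × ℝ) : 0 ≤ heatExt θ p :=
  mul_nonneg (inv_nonneg.2 (gaussMass_pos m).le)
    (integral_nonneg fun _ => mul_nonneg (h0 _) (Real.exp_pos _).le)

lemma heatExt_le_one (hθ : Continuous θ) (h0 : ∀ z, 0 ≤ θ z) (h1 : ∀ z, θ z ≤ 1)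
    (p : Spc m × ℝ) : heatExt θ p ≤ 1 := by
  have : ∫ u : Spc m, θ (p.1 - √p.2 • u) * Real.exp (-‖u‖ ^ 2 / 4) ≤ gaussMass m :=
    integral_mono (integrable_heatExt hθ h0 h1 p) (integrable_gauss m)
      fun u => mul_le_of_le_one_left (Real.exp_pos _).le (h1 _)
  rw [heatExt, inv_mul_le_iff₀ (gaussMass_pos m)]
  simpa using this

lemma heatExt_eq (y : Spc m) {t : ℝ} (ht : 0 < t) :
    heatExt θ (y, t) = (gaussMass m)⁻¹ * ∫ z, θ z * heatKer m t (‖y - z‖ ^ 2) := by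
  have hs : 0 < √t := Real.sqrt_pos.2 ht
  have hpow : √t ^ (m + 1) = Real.exp ((m + 1) / 2 * Real.log t) := by
    rw [← Real.exp_log hs, ← Real.exp_nat_mul, Real.log_sqrt ht.le]
    congr 1; push_cast; ring
  simp only [heatExt]
  congr 1
  have h1 : (∫ u : Spc m, θ (y - √t • u) * Real.exp (-‖u‖ ^ 2 / 4)) =
      ∫ u : Spc m, (fun v => θ (y - v) * Real.exp (-‖v‖ ^ 2 / (4 * t))) (√t • u) := by
    congr 1; funext u
    simp only [norm_smul, mul_pow, Real.norm_of_nonneg hs.le, Real.sq_sqrt ht.le]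
    congr 2; field_simp
  rw [h1, Measure.integral_comp_smul volume
    (fun v : Spc m => θ (y - v) * Real.exp (-‖v‖ ^ 2 / (4 * t))) (√t), finrank_euclideanSpace, Fintype.card_fin, hpow,
    abs_of_pos (inv_pos.2 (Real.exp_pos _)), ← Real.exp_neg, smul_eq_mul]
  have h2 := integral_sub_left_eq_self
    (fun z : Spc m => θ z * Real.exp (-‖y - z‖ ^ 2 / (4 * t))) volume y
  simp only [sub_sub_cancel] at h2
  rw [h2, ← integral_const_mul]
  congr 1; funext z
  simp only [heatKer, sub_eq_add_neg (_ / (4 * t)), Real.exp_add]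
  ring

lemma heatExt_pde (hθ : Continuous θ) (hθc : HasCompactSupport θ) (y : Spc m) {t : ℝ}
    (ht : 0 < t) :
    ∃ D, HasLap (fun z => heatExt θ (z, t)) y D ∧ HasDerivAt (fun s => heatExt θ (y, s)) D t := by
  set Z := (gaussMass m)⁻¹
  refine ⟨Z * ∫ z, θ z * ((‖y - z‖ ^ 2 / (4 * t ^ 2) - (m + 1) / (2 * t)) *
    heatKer m t (‖y - z‖ ^ 2)), ?_, ?_⟩
  · have h1 : (fun z => heatExt θ (z, t)) =
        fun y => Z * ∫ z, θ z * heatKer m t (‖y - z‖ ^ 2) := by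
      funext y; exact heatExt_eq y ht
    rw [h1]
    refine HasLap.const_mul Z ?_
    obtain ⟨P, hP⟩ : ∃ P : Fin (m + 1) → ℝ → Spc m → ℝ, P = fun i s z =>
      heatKer m t (‖y - z‖ ^ 2 + 2 * s * (y i - z i) + s ^ 2) := ⟨_, rfl⟩
    obtain ⟨B, hB⟩ : ∃ B : Fin (m + 1) → ℝ → Spc m → ℝ, B = fun i s z =>
      -(2 * (y i - z i) + 2 * s) / (4 * t) := ⟨_, rfl⟩
    have hPe : ∀ i s z, heatKer m t (‖y + s • eVec m i - z‖ ^ 2) = P i s z := fun i s z => by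
      rw [hP, norm_line_sq]
    have hPc : ∀ i, Continuous fun q : ℝ × Spc m => P i q.1 q.2 := fun i => by
      simp only [hP, heatKer]; fun_prop
    have hBc : ∀ i, Continuous fun q : ℝ × Spc m => B i q.1 q.2 := fun i => by
      simp only [hB]; fun_prop
    have hPd : ∀ i s z, HasDerivAt (fun s => P i s z) (B i s z * P i s z) s := fun i s z => by
      have h2 : HasDerivAt (fun s : ℝ => ‖y - z‖ ^ 2 + 2 * s * (y i - z i) + s ^ 2)
          (2 * (y i - z i) + 2 * s) s := by
        have := (((hasDerivAt_id s).const_mul 2).mul_const (y i - z i)).const_add (‖y - z‖ ^ 2)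
          |>.add ((hasDerivAt_id s).pow 2)
        refine this.congr_deriv ?_
        simp
      have h3 := ((h2.neg.div_const (4 * t)).sub_const ((m + 1) / 2 * Real.log t)).exp
      rw [hP, hB]
      refine HasDerivAt.congr_deriv (f := fun s : ℝ => heatKer m t _) h3 ?_
      exact mul_comm _ _
    have hBd : ∀ i s z, HasDerivAt (fun s => B i s z) (-(1 / (2 * t))) s := fun i s z => by
      have := ((((hasDerivAt_id s).const_mul 2).const_add (2 * (y i - z i))).neg).div_const (4 * t)
      rw [hB]
      refine HasDerivAt.congr_deriv (f := fun s : ℝ => -(2 * (y i - z i) + 2 * s) / (4 * t)) this ?_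
      field_simp; norm_num
    refine ⟨fun i => ∫ z, θ z * (-(1 / (2 * t)) * P i 0 z + B i 0 z * (B i 0 z * P i 0 z)),
      fun i => ⟨fun s => ∫ z, θ z * (B i s z * P i s z), Eventually.of_forall fun s => ?_, ?_⟩, ?_⟩
    · simp only [hPe]
      refine hasDerivAt_integral_compactSupport hθ hθc one_pos (F := P i)
        (F' := fun s z => B i s z * P i s z) ?_ ?_ ?_
      · intro s _
        exact (hPc i).comp (by fun_prop : Continuous fun z : Spc m => (s, z))
      · exact ((hBc i).mul (hPc i)).continuousOn
      · intro s _ z; exact hPd i s z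
    · refine hasDerivAt_integral_compactSupport hθ hθc one_pos
        (F := fun s z => B i s z * P i s z)
        (F' := fun s z => -(1 / (2 * t)) * P i s z + B i s z * (B i s z * P i s z)) ?_ ?_ ?_
      · intro s _
        exact ((hBc i).mul (hPc i)).comp (by fun_prop : Continuous fun z : Spc m => (s, z))
      · exact ((continuous_const.mul (hPc i)).add
          ((hBc i).mul ((hBc i).mul (hPc i)))).continuousOn
      · intro s _ z; exact (hBd i s z).mul (hPd i s z)
    · rw [← integral_finsetSum]
      · congr 1; funext z
        have h0 : ∀ i, P i 0 z = heatKer m t (‖y - z‖ ^ 2) := fun i => by simp [hP]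
        simp only [h0, ← Finset.mul_sum]
        congr 1
        have h5 : ‖y - z‖ ^ 2 = ∑ i, (y i - z i) ^ 2 := by
          rw [EuclideanSpace.norm_sq_eq]; simp
        calc _ = ∑ i, ((y i - z i) ^ 2 / (4 * t ^ 2) - 1 / (2 * t)) *
              heatKer m t (‖y - z‖ ^ 2) := by
              refine Finset.sum_congr rfl fun i _ => ?_
              simp only [hB]; field_simp; ring
          _ = _ := by
              rw [← Finset.sum_mul, Finset.sum_sub_distrib, ← Finset.sum_div, ← h5]
              congr 2; simp; ring
      · intro i _
        refine Continuous.integrable_of_hasCompactSupport ?_ hθc.mul_right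
        have hi : Continuous fun z : Spc m => ((0 : ℝ), z) := by fun_prop
        exact hθ.mul (((continuous_const.mul (hPc i)).add
          ((hBc i).mul ((hBc i).mul (hPc i)))).comp hi)
  · have h1 : (fun s => heatExt θ (y, s)) =ᶠ[𝓝 t]
        fun s => Z * ∫ z, θ z * heatKer m s (‖y - z‖ ^ 2) := by
      filter_upwards [lt_mem_nhds ht] with s hs using heatExt_eq y hs
    refine HasDerivAt.congr_of_eventuallyEq (HasDerivAt.const_mul Z ?_) h1
    have hpos : ∀ s ∈ Metric.closedBall t (t / 2), 0 < s := fun s hs => by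
      rw [Metric.mem_closedBall, Real.dist_eq, abs_le] at hs; linarith
    refine hasDerivAt_integral_compactSupport hθ hθc (half_pos ht)
      (F := fun s z => heatKer m s (‖y - z‖ ^ 2))
      (F' := fun s z => (‖y - z‖ ^ 2 / (4 * s ^ 2) - (m + 1) / (2 * s)) *
        heatKer m s (‖y - z‖ ^ 2)) ?_ ?_ ?_
    · intro s _; simp only [heatKer]; fun_prop
    · intro q hq
      have hq0 : q.1 ≠ 0 := (hpos q.1 hq.1).ne'
      refine ContinuousAt.continuousWithinAt ?_
      simp only [heatKer]
      have : 4 * q.1 ≠ 0 := by positivity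
      have : 2 * q.1 ≠ 0 := by positivity
      have : 4 * q.1 ^ 2 ≠ 0 := by positivity
      fun_prop (disch := assumption)
    · intro s hs z
      have hs0 := hpos s hs
      have h2 : HasDerivAt (fun s : ℝ => -‖y - z‖ ^ 2 / (4 * s) - (m + 1) / 2 * Real.log s)
          (‖y - z‖ ^ 2 / (4 * s ^ 2) - (m + 1) / (2 * s)) s := by
        have h3 := ((hasDerivAt_const s (-‖y - z‖ ^ 2)).div ((hasDerivAt_id s).const_mul 4)
          (by simp; exact hs0.ne')).sub ((Real.hasDerivAt_log hs0.ne').const_mul (((m:ℝ) + 1) / 2))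
        refine h3.congr_deriv ?_
        simp; field_simp
      refine h2.exp.congr_deriv ?_
      simp only [heatKer]; exact mul_comm _ _

lemma hasHeat_heatExt (hθ : Continuous θ) (hθc : HasCompactSupport θ) {p : Spc m × ℝ} {a : ℝ}
    (hp : a < p.2) : HasHeat (fun q => heatExt θ (q.1, q.2 - a)) p := by
  obtain ⟨D, h1, h2⟩ := heatExt_pde hθ hθc p.1 (sub_pos.2 hp)
  exact ⟨D, h1, (h2.comp_sub_const p.2 a).hasDerivWithinAt⟩

lemma heatExt_le (hθ : Continuous θ) (hθc : HasCompactSupport θ) (h0 : ∀ z, 0 ≤ θ z)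
    (y : Spc m) {t : ℝ} (ht : 0 < t) :
    heatExt θ (y, t) ≤ (gaussMass m)⁻¹ * heatKer m t 0 * ∫ z, θ z := by
  rw [heatExt_eq y ht, mul_assoc, ← integral_const_mul (heatKer m t 0)]
  refine mul_le_mul_of_nonneg_left ?_ (inv_nonneg.2 (gaussMass_pos m).le)
  refine integral_mono ?_ ?_ fun z => ?_
  · refine Continuous.integrable_of_hasCompactSupport ?_ hθc.mul_right
    simp only [heatKer]; fun_prop
  · exact (continuous_const.mul hθ).integrable_of_hasCompactSupport hθc.mul_left
  · dsimp only
    rw [mul_comm]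
    refine mul_le_mul_of_nonneg_right ?_ (h0 z)
    unfold heatKer
    gcongr
    exact sq_nonneg _

lemma le_heatExt (hθ : Continuous θ) (hθc : HasCompactSupport θ) (h0 : ∀ z, 0 ≤ θ z)
    (y : Spc m) {t D : ℝ} (ht : 0 < t) (hD : ∀ z, θ z ≠ 0 → ‖y - z‖ ≤ D) :
    (gaussMass m)⁻¹ * heatKer m t (D ^ 2) * ∫ z, θ z ≤ heatExt θ (y, t) := by
  rw [heatExt_eq y ht, mul_assoc, ← integral_const_mul (heatKer m t (D ^ 2))]
  refine mul_le_mul_of_nonneg_left ?_ (inv_nonneg.2 (gaussMass_pos m).le)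
  refine integral_mono ?_ ?_ fun z => ?_
  · exact (continuous_const.mul hθ).integrable_of_hasCompactSupport hθc.mul_left
  · refine Continuous.integrable_of_hasCompactSupport ?_ hθc.mul_right
    simp only [heatKer]; fun_prop
  · dsimp only
    by_cases hz : θ z = 0
    · simp [hz]
    rw [mul_comm]
    refine mul_le_mul_of_nonneg_left ?_ (h0 z)
    unfold heatKer
    have := hD z hz
    gcongr

end HeatExt

/-- The caloric lateral barrier `(|y-x₀|² + 2n(t-a))/R²`. -/
def latBar {m : ℕ} (x0 : Spc m) (R a : ℝ) (p : Spc m × ℝ) : ℝ :=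
  (‖p.1 - x0‖ ^ 2 + 2 * (m + 1) * (p.2 - a)) / R ^ 2

section LatBar

variable {m : ℕ} (x0 : Spc m) (R a : ℝ)

lemma continuous_latBar : Continuous (latBar x0 R a) := by unfold latBar; fun_prop

lemma latBar_hasLap (y : Spc m) (t : ℝ) :
    HasLap (fun z => latBar x0 R a (z, t)) y (2 * (m + 1) / R ^ 2) := by
  have h := ((hasLap_norm_sq (x := y) x0).add
    (hasLap_const (2 * (m + 1) * (t - a)))).const_mul ((R ^ 2)⁻¹)
  have he : (fun z => latBar x0 R a (z, t)) =
      fun y => (R ^ 2)⁻¹ * (‖y - x0‖ ^ 2 + 2 * (m + 1) * (t - a)) := by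
    funext z; simp only [latBar]; ring
  rw [he]
  convert h using 1
  ring

lemma latBar_hasDerivAt (y : Spc m) (t : ℝ) :
    HasDerivAt (fun s => latBar x0 R a (y, s)) (2 * (m + 1) / R ^ 2) t := by
  have h := ((((hasDerivAt_id t).sub_const a).const_mul (2 * ((m : ℝ) + 1))).const_add
    (‖y - x0‖ ^ 2)).div_const (R ^ 2)
  simpa [latBar] using h

variable {x0 R a}

lemma latBar_nonneg {p : Spc m × ℝ} (hp : a ≤ p.2) : 0 ≤ latBar x0 R a p := by
  unfold latBar
  have : 0 ≤ p.2 - a := by linarith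
  positivity

lemma hasHeat_latBar (p : Spc m × ℝ) : HasHeat (latBar x0 R a) p :=
  ⟨_, latBar_hasLap x0 R a p.1 p.2, (latBar_hasDerivAt x0 R a p.1 p.2).hasDerivWithinAt⟩

lemma one_le_latBar (hR : 0 < R) {y : Spc m} {t : ℝ} (hy : ‖y - x0‖ = R) (ht : a ≤ t) :
    1 ≤ latBar x0 R a (y, t) := by
  unfold latBar
  rw [hy, le_div_iff₀ (by positivity)]
  have : 0 ≤ 2 * ((m : ℝ) + 1) * (t - a) := mul_nonneg (by positivity) (by linarith)
  simp only; linarith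

end LatBar

/-- Truncation to the unit interval. -/
def clamp (u : ℝ) : ℝ := max 0 (min 1 u)

lemma continuous_clamp : Continuous clamp := by unfold clamp; fun_prop

lemma clamp_nonneg (u : ℝ) : 0 ≤ clamp u := le_max_left _ _

lemma clamp_le_one (u : ℝ) : clamp u ≤ 1 := max_le zero_le_one (min_le_left _ _)

lemma clamp_of_nonpos {u : ℝ} (h : u ≤ 0) : clamp u = 0 :=
  max_eq_left ((min_le_right _ _).trans h)

lemma clamp_of_one_le {u : ℝ} (h : 1 ≤ u) : clamp u = 1 := by
  rw [clamp, min_eq_left h, max_eq_right zero_le_one]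

/-- A continuous cutoff equal to `1` on the ball of radius `ρ` and to `0` off that of radius `2ρ`. -/
def cutoff {m : ℕ} (x0 : Spc m) (ρ : ℝ) (z : Spc m) : ℝ := clamp (2 - ‖z - x0‖ / ρ)

section Cutoff

variable {m : ℕ} {x0 : Spc m} {ρ : ℝ}

lemma continuous_cutoff : Continuous (cutoff x0 ρ) := by
  unfold cutoff
  exact continuous_clamp.comp (by fun_prop)

lemma cutoff_eq_one (hρ : 0 < ρ) {z : Spc m} (hz : ‖z - x0‖ ≤ ρ) : cutoff x0 ρ z = 1 := by
  refine clamp_of_one_le ?_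
  have : ‖z - x0‖ / ρ ≤ 1 := (div_le_one hρ).2 hz
  linarith

lemma norm_le_of_cutoff_ne_zero (hρ : 0 < ρ) {z : Spc m} (hz : cutoff x0 ρ z ≠ 0) :
    ‖z - x0‖ ≤ 2 * ρ := by
  by_contra! h
  refine hz (clamp_of_nonpos ?_)
  have : 2 ≤ ‖z - x0‖ / ρ := (le_div_iff₀ hρ).2 h.le
  linarith

lemma tsupport_cutoff_subset (hρ : 0 < ρ) :
    tsupport (cutoff x0 ρ) ⊆ Metric.closedBall x0 (2 * ρ) :=
  closure_minimal (fun z hz => by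
    simpa [dist_eq_norm] using norm_le_of_cutoff_ne_zero hρ hz) Metric.isClosed_closedBall

lemma hasCompactSupport_cutoff (hρ : 0 < ρ) : HasCompactSupport (cutoff x0 ρ) :=
  (isCompact_closedBall x0 (2 * ρ)).of_isClosed_subset (isClosed_tsupport _)
    (tsupport_cutoff_subset hρ)

lemma continuous_cutoff_mul (hρ : 0 < ρ) {f : Spc m → ℝ}
    (hf : ∀ z ∈ Metric.closedBall x0 (2 * ρ), ContinuousAt f z) :
    Continuous fun z => cutoff x0 ρ z * f z :=
  continuous_of_tsupport fun z hz => continuous_cutoff.continuousAt.mul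
    (hf z (tsupport_cutoff_subset hρ (tsupport_mul_subset_left hz)))

end Cutoff

section LowerSemicontinuity

variable {m : ℕ} {w : Spc m × ℝ → ℝ}

lemma SolvesHeat.continuousAt_slice {Ω : Set (Spc m × ℝ)} (h : SolvesHeat w Ω) {x : Spc m} {t : ℝ}
    (hp : (x, t) ∈ Ω) : ContinuousAt (fun y => w (y, t)) x := (h _ hp).1.continuousAt

lemma SolvesHeat.continuousAt_time {Ω : Set (Spc m × ℝ)} (h : SolvesHeat w Ω) {x : Spc m} {t : ℝ}
    (hp : (x, t) ∈ Ω) : ContinuousAt (fun s => w (x, s)) t := (h _ hp).2.continuousAt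

/-- A lower bound on one time slice propagates forward in time, up to lateral losses, for a
solution that is forward lower semicontinuous at later times. -/
lemma lower_bound_propagates {U : Set (Spc m × ℝ)} (hw : SolvesHeat w U)
    (hlow : ∀ p ∈ U, -1 ≤ w p) {x0 : Spc m} {d t0 s1 s c0 δ : ℝ} (hd : 0 < d) (hδ : 0 < δ)
    (ht0 : t0 ≤ s1) (hs : s1 < s) (hU : Metric.closedBall x0 (2 * d) ×ˢ Icc s1 s ⊆ U)
    (hsl : ∀ y ∈ Metric.closedBall x0 (2 * d), c0 ≤ w (y, s1))
    (hlsc : ∀ p ∈ Metric.closedBall x0 d ×ˢ Ioc s1 s,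
      LowerSemicontinuousWithinAt w {q | p.2 ≤ q.2} p) {y : Spc m}
    (hy : y ∈ Metric.closedBall x0 d) :
    c0 - δ - (1 + |c0|) * latBar x0 d t0 (y, s) ≤ w (y, s) := by
  set M : ℝ := 1 + |c0| with hM
  have hM0 : 0 ≤ M := by positivity
  have hMc : c0 + 1 ≤ M := by linarith [le_abs_self c0]
  obtain ⟨θ, hθdef⟩ : ∃ θ : ℝ → Spc m → ℝ,
      θ = fun s' z => cutoff x0 d z * clamp ((c0 - w (z, s')) / δ) := ⟨_, rfl⟩
  have hd2 : Metric.closedBall x0 d ⊆ Metric.closedBall x0 (2 * d) :=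
    Metric.closedBall_subset_closedBall (by linarith)
  have hθ0 : ∀ s' z, 0 ≤ θ s' z := fun s' z => by
    rw [hθdef]; exact mul_nonneg (clamp_nonneg _) (clamp_nonneg _)
  have hθle : ∀ s' z, θ s' z ≤ cutoff x0 d z := fun s' z => by
    rw [hθdef]; exact mul_le_of_le_one_right (clamp_nonneg _) (clamp_le_one _)
  have hθ1 : ∀ s' z, θ s' z ≤ 1 := fun s' z => (hθle s' z).trans (clamp_le_one _)
  have hθs : ∀ s', HasCompactSupport (θ s') := fun s' => by
    rw [hθdef]; exact (hasCompactSupport_cutoff hd).mul_right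
  have hθc : ∀ s' ∈ Icc s1 s, Continuous (θ s') := fun s' hs' => by
    rw [hθdef]
    refine continuous_cutoff_mul hd fun z hz => ?_
    have h1 := hw.continuousAt_slice (hU (mk_mem_prod hz hs'))
    exact continuous_clamp.continuousAt.comp ((continuousAt_const.sub h1).div_const δ)
  have key : ∀ s' ∈ Ioo s1 s, c0 - δ - M * latBar x0 d t0 (y, s) -
      M * ((gaussMass m)⁻¹ * heatKer m (s - s') 0 * ∫ z, θ s' z) ≤ w (y, s) := by
    intro s' hs'
    have hs'I : s' ∈ Icc s1 s := ⟨hs'.1.le, hs'.2.le⟩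
    have hC := hθc s' hs'I
    set Ψ : Spc m × ℝ → ℝ := fun q => w q + ((δ - c0) + (M * latBar x0 d t0 q +
      M * heatExt (θ s') (q.1, q.2 - s'))) with hΨ
    have hH0 : ∀ q, 0 ≤ M * heatExt (θ s') q := fun q => mul_nonneg hM0 (heatExt_nonneg (hθ0 s') q)
    have hsub : Metric.closedBall x0 d ×ˢ Icc s' s ⊆ U := fun q hq =>
      hU ⟨hd2 hq.1, hs'.1.le.trans hq.2.1, hq.2.2⟩
    have hmp := minimum_principle Ψ x0 d s' s ?_ ?_ ?_ ?_ (y, s) ⟨hy, hs'.2.le, le_rfl⟩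
    · have h2 := heatExt_le hC (hθs s') (hθ0 s') y (sub_pos.2 hs'.2)
      have h3 := mul_le_mul_of_nonneg_left h2 hM0
      simp only [hΨ] at hmp
      linarith
    · intro z hz
      have hb : 0 ≤ M * latBar x0 d t0 (z, s') := mul_nonneg hM0 (latBar_nonneg (ht0.trans hs'.1.le))
      have h1 := hlow _ (hsub (mk_mem_prod hz (left_mem_Icc.2 hs'.2.le)))
      have hz1 : cutoff x0 d z = 1 := cutoff_eq_one hd (by simpa [dist_eq_norm] using hz)
      simp only [hΨ, sub_self, heatExt_zero]
      by_cases hlt : c0 - δ ≤ w (z, s')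
      · have := mul_nonneg hM0 (hθ0 s' z); linarith
      · have : θ s' z = 1 := by
          rw [hθdef]; simp only [hz1, one_mul]
          exact clamp_of_one_le ((one_le_div hδ).2 (by linarith))
        rw [this]; linarith
    · intro z t hz ht
      have h1 := hlow (z, t) (hsub ⟨by simp [dist_eq_norm, hz], ht⟩)
      have h2 := one_le_latBar hd hz (ht0.trans (hs'.1.le.trans ht.1))
      have h3 := mul_le_mul_of_nonneg_left h2 hM0
      have := hH0 (z, t - s')
      simp only [hΨ]; linarith
    · intro p hp c _ hc
      have h1 := hlsc p ⟨hp.1, hs'.1.trans_le hp.2.1, hp.2.2⟩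
      have h2 : Continuous fun q : Spc m × ℝ => (δ - c0) + (M * latBar x0 d t0 q +
          M * heatExt (θ s') (q.1, q.2 - s')) := by
        have := continuous_heatExt hC (hθ0 s') (hθ1 s')
        have := continuous_latBar x0 d t0
        fun_prop
      exact (h1.add h2.continuousWithinAt.lowerSemicontinuousWithinAt).mono (fun q hq => hq.2) c hc
    · intro z t hz ht hts _
      have hmem : (z, t) ∈ U := hsub ⟨by simpa [dist_eq_norm] using hz.le, ht.le, hts⟩
      exact (hw.hasHeat hmem).add ((hasHeat_const _).add
        (((hasHeat_latBar _).const_mul M).add ((hasHeat_heatExt hC (hθs s') ht).const_mul M)))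
  have hint : Tendsto (fun s' => ∫ z, θ s' z) (𝓝[>] s1) (𝓝 0) := by
    have hI : ∀ᶠ s' in 𝓝[>] s1, s' ∈ Ioo s1 s := Ioo_mem_nhdsGT hs
    have := tendsto_integral_filter_of_dominated_convergence (μ := volume) (l := 𝓝[>] s1)
      (F := θ) (f := fun _ => 0) (cutoff x0 d) ?_ ?_ ?_ ?_
    · simpa using this
    · filter_upwards [hI] with s' hs'
      exact (hθc s' ⟨hs'.1.le, hs'.2.le⟩).aestronglyMeasurable
    · refine Eventually.of_forall fun s' => Eventually.of_forall fun z => ?_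
      rw [Real.norm_of_nonneg (hθ0 s' z)]; exact hθle s' z
    · exact continuous_cutoff.integrable_of_hasCompactSupport (hasCompactSupport_cutoff hd)
    · refine Eventually.of_forall fun z => ?_
      by_cases hz : cutoff x0 d z = 0
      · rw [hθdef]; simp [hz]
      · have hzb : z ∈ Metric.closedBall x0 (2 * d) := by
          simpa [dist_eq_norm] using norm_le_of_cutoff_ne_zero hd hz
        have h1 := hw.continuousAt_time (hU (mk_mem_prod hzb (left_mem_Icc.2 hs.le)))
        have h2 : ContinuousAt (fun s' => θ s' z) s1 := by
          rw [hθdef]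
          exact continuousAt_const.mul (continuous_clamp.continuousAt.comp
            ((continuousAt_const.sub h1).div_const δ))
        have h3 : θ s1 z = 0 := by
          rw [hθdef]; dsimp only
          rw [clamp_of_nonpos (div_nonpos_of_nonpos_of_nonneg (by linarith [hsl z hzb]) hδ.le),
            mul_zero]
        have h4 := h2.tendsto.mono_left (nhdsWithin_le_nhds (s := Ioi s1))
        rwa [h3] at h4
  have hker : Tendsto (fun s' => heatKer m (s - s') 0) (𝓝[>] s1) (𝓝 (heatKer m (s - s1) 0)) := by
    have : ContinuousAt (fun s' => heatKer m (s - s') 0) s1 := by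
      have h1 : s - s1 ≠ 0 := (sub_pos.2 hs).ne'
      have h2 : 4 * (s - s1) ≠ 0 := by simpa using h1
      unfold heatKer
      fun_prop (disch := assumption)
    exact this.tendsto.mono_left nhdsWithin_le_nhds
  have hlim := (((hker.const_mul (gaussMass m)⁻¹).mul hint).const_mul M).const_sub
    (c0 - δ - M * latBar x0 d t0 (y, s))
  rw [mul_zero, mul_zero, sub_zero] at hlim
  refine le_of_tendsto hlim ?_
  filter_upwards [Ioo_mem_nhdsGT hs] with s' hs' using key s' hs'

/-- Forward lower semicontinuity at points of a relatively closed set on which `w` is uniformly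
Lipschitz along time lines and time slices, given forward lower semicontinuity elsewhere. -/
lemma lsc_of_lipschitz_on {U S : Set (Spc m × ℝ)} (hUo : IsOpen U) (hw : SolvesHeat w U)
    (hlow : ∀ p ∈ U, -1 ≤ w p) (hSo : IsOpen (U \ S)) {k : ℝ} (hk : 0 < k)
    (hL : ∀ p ∈ U \ S, LowerSemicontinuousWithinAt w {q | p.2 ≤ q.2} p)
    (htime : ∀ x t s, (x, t) ∈ S → (x, t) ∈ U → (x, s) ∈ U → |w (x, s) - w (x, t)| ≤ k * |s - t|)
    (hspace : ∀ x y t, (x, t) ∈ S → (x, t) ∈ U → (y, t) ∈ U →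
      |w (y, t) - w (x, t)| ≤ k * ‖y - x‖) {P : Spc m × ℝ} (hPS : P ∈ S) (hPU : P ∈ U) :
    LowerSemicontinuousWithinAt w {q | P.2 ≤ q.2} P := by
  obtain ⟨x0, t0⟩ := P
  intro c hc
  obtain ⟨ε, hε, hball⟩ := Metric.isOpen_iff.1 hUo _ hPU
  obtain ⟨d, hd, hdε, hdk⟩ : ∃ d > 0, 2 * d < ε ∧ 6 * k * d < w (x0, t0) - c := by
    refine ⟨min (ε / 4) ((w (x0, t0) - c) / (12 * k)), ?_, ?_, ?_⟩
    · have : 0 < w (x0, t0) - c := by linarith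
      positivity
    · linarith [min_le_left (ε / 4) ((w (x0, t0) - c) / (12 * k))]
    · have h := min_le_right (ε / 4) ((w (x0, t0) - c) / (12 * k))
      have h2 := mul_le_mul_of_nonneg_left h (show 0 ≤ 6 * k by positivity)
      have h3 : 6 * k * ((w (x0, t0) - c) / (12 * k)) = (w (x0, t0) - c) / 2 := by
        field_simp; norm_num
      linarith
  have hcyl : Metric.closedBall x0 (2 * d) ×ˢ Icc t0 (t0 + d) ⊆ U := by
    rintro ⟨y, s⟩ ⟨hy, hs⟩
    refine hball ?_
    rw [Metric.mem_ball, Prod.dist_eq]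
    simp only [Metric.mem_closedBall, mem_Icc] at hy hs
    refine max_lt (by simp only; linarith) ?_
    simp only [Real.dist_eq]
    rw [abs_of_nonneg (by linarith)]; linarith
  set c0 := w (x0, t0) - 5 * k * d with hc0
  have hkd : 0 < k * d := by positivity
  have main : ∀ y ∈ Metric.closedBall x0 d, ∀ s ∈ Icc t0 (t0 + d),
      c0 - k * d - (1 + |c0|) * latBar x0 d t0 (y, s) ≤ w (y, s) := by
    intro y hy s hs
    set Kc := Metric.closedBall x0 d ×ˢ Icc t0 s with hKc
    have hKU : Kc ⊆ U := fun q hq => hcyl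
      ⟨Metric.closedBall_subset_closedBall (by linarith) hq.1, hq.2.1, hq.2.2.trans hs.2⟩
    have hcomp : IsCompact (Kc \ (U \ S)) :=
      ((isCompact_closedBall x0 d).prod isCompact_Icc).diff hSo
    have hx0 : (x0, t0) ∈ Kc \ (U \ S) :=
      ⟨⟨Metric.mem_closedBall_self hd.le, le_rfl, hs.1⟩, fun h => h.2 hPS⟩
    obtain ⟨⟨x1, s1⟩, hp1, hmax⟩ := hcomp.exists_isMaxOn ⟨_, hx0⟩ continuous_snd.continuousOn
    have hp1S : (x1, s1) ∈ S := by_contra fun h => hp1.2 ⟨hKU hp1.1, h⟩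
    have hs1 : s1 ∈ Icc t0 s := hp1.1.2
    have hx1 : ‖x1 - x0‖ ≤ d := by simpa [dist_eq_norm] using hp1.1.1
    have hsl : ∀ z ∈ Metric.closedBall x0 (2 * d), c0 ≤ w (z, s1) := by
      intro z hz
      have hz' : ‖z - x0‖ ≤ 2 * d := by simpa [dist_eq_norm] using hz
      have h1 := hspace x1 z s1 hp1S (hKU hp1.1) (hcyl ⟨hz, hs1.1, hs1.2.trans hs.2⟩)
      have hx1t0 : (x1, t0) ∈ U := hKU ⟨hp1.1.1, le_rfl, hs.1⟩
      have h2 := htime x1 s1 t0 hp1S (hKU hp1.1) hx1t0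
      have h3 := hspace x0 x1 t0 hPS hPU hx1t0
      have e1 : ‖z - x1‖ ≤ 3 * d := by
        have : z - x1 = (z - x0) - (x1 - x0) := by abel
        rw [this]; linarith [norm_sub_le (z - x0) (x1 - x0)]
      have e2 : |t0 - s1| ≤ d := by
        rw [abs_sub_comm, abs_of_nonneg (by linarith [hs1.1])]
        linarith [hs1.2, hs.2]
      have f1 := mul_le_mul_of_nonneg_left e1 hk.le
      have f2 := mul_le_mul_of_nonneg_left e2 hk.le
      have f3 := mul_le_mul_of_nonneg_left hx1 hk.le
      rw [abs_le] at h1 h2 h3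
      linarith [h1.1, h2.2, h3.1]
    rcases eq_or_lt_of_le hs1.2 with h | h
    · have h1 := hsl y (Metric.closedBall_subset_closedBall (by linarith) hy)
      have h2 : 0 ≤ (1 + |c0|) * latBar x0 d t0 (y, s) :=
        mul_nonneg (by positivity) (latBar_nonneg hs.1)
      rw [h] at h1; linarith
    · refine lower_bound_propagates hw hlow hd hkd hs1.1 h ?_ hsl ?_ hy
      · exact fun q hq => hcyl ⟨hq.1, hs1.1.trans hq.2.1, hq.2.2.trans hs.2⟩
      · rintro p ⟨hpx, hpt⟩
        have hpK : p ∈ Kc := ⟨hpx, hs1.1.trans hpt.1.le, hpt.2⟩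
        refine hL p (by_contra fun hcon => ?_)
        have := hmax (show p ∈ Kc \ (U \ S) from ⟨hpK, hcon⟩)
        exact absurd hpt.1 (not_lt.2 this)
  have hcont : Continuous fun q => c0 - k * d - (1 + |c0|) * latBar x0 d t0 q :=
    continuous_const.sub (continuous_const.mul (continuous_latBar x0 d t0))
  have hval : c < c0 - k * d - (1 + |c0|) * latBar x0 d t0 (x0, t0) := by
    have : latBar x0 d t0 (x0, t0) = 0 := by simp [latBar]
    rw [this]; simp only [hc0]; linarith
  have e1 := nhdsWithin_le_nhds (s := {q : Spc m × ℝ | (x0, t0).2 ≤ q.2})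
    (hcont.continuousAt.eventually (lt_mem_nhds hval))
  have e2 : ∀ᶠ q : Spc m × ℝ in 𝓝[{q | (x0, t0).2 ≤ q.2}] (x0, t0), dist q (x0, t0) < d :=
    nhdsWithin_le_nhds (Metric.ball_mem_nhds _ hd)
  filter_upwards [e1, e2, self_mem_nhdsWithin] with q h1 h2 h3
  rw [Prod.dist_eq, max_lt_iff] at h2
  refine h1.trans_le (main q.1 h2.1.le q.2 ⟨h3, ?_⟩)
  have := h2.2
  rw [Real.dist_eq, abs_lt] at this
  simp only at this; linarith

end LowerSemicontinuity

/-- A pointwise solution of the heat equation that is bounded below is lower semicontinuous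
forward in time, although no joint continuity is assumed. -/
theorem SolvesHeat.lowerSemicontinuousWithinAt {m : ℕ} {w : Spc m × ℝ → ℝ} {O : Set (Spc m × ℝ)}
    (hO : IsOpen O) (hw : SolvesHeat w O) (hlow : ∀ p ∈ O, -1 ≤ w p) :
    ∀ p ∈ O, LowerSemicontinuousWithinAt w {q | p.2 ≤ q.2} p := by
  by_contra! hcon
  obtain ⟨p0, hp0, hnot⟩ := hcon
  set G := interior {p | p ∈ O ∧ LowerSemicontinuousWithinAt w {q | p.2 ≤ q.2} p} with hG
  have hGL : ∀ p ∈ G, LowerSemicontinuousWithinAt w {q | p.2 ≤ q.2} p :=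
    fun p hp => (interior_subset hp).2
  set S := O \ G with hS
  have hSlc : IsLocallyClosed S := hO.isLocallyClosed.inter
    (isOpen_interior.isClosed_compl.isLocallyClosed)
  have : LocallyCompactSpace S := hSlc.locallyCompactSpace
  have : Nonempty S := ⟨⟨p0, hp0, fun h => hnot (hGL p0 h)⟩⟩
  set A : ℕ → Set S := fun k => {p | (∀ s, (p.1.1, s) ∈ O → |s - p.1.2| < 1 / ((k : ℝ) + 1) →
      |w (p.1.1, s) - w p.1| ≤ (k + 1) * |s - p.1.2|) ∧
    (∀ y, (y, p.1.2) ∈ O → ‖y - p.1.1‖ < 1 / ((k : ℝ) + 1) →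
      |w (y, p.1.2) - w p.1| ≤ (k + 1) * ‖y - p.1.1‖)} with hA
  have hclosed : ∀ k, IsClosed (A k) := by
    intro k
    refine IsSeqClosed.isClosed fun u p hu hup => ?_
    have hup' : Tendsto (fun j => ((u j : S) : Spc m × ℝ)) atTop (𝓝 p.1) :=
      continuous_subtype_val.continuousAt.tendsto.comp hup
    have hx : Tendsto (fun j => (u j).1.1) atTop (𝓝 p.1.1) :=
      continuous_fst.continuousAt.tendsto.comp hup'
    have ht : Tendsto (fun j => (u j).1.2) atTop (𝓝 p.1.2) :=
      continuous_snd.continuousAt.tendsto.comp hup'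
    have hpO : (p.1.1, p.1.2) ∈ O := p.2.1
    have hw1 : Tendsto (fun j => w ((u j).1.1, p.1.2)) atTop (𝓝 (w p.1)) :=
      (hw.continuousAt_slice hpO).tendsto.comp hx
    have hdt : Tendsto (fun j => ((k : ℝ) + 1) * |p.1.2 - (u j).1.2|) atTop (𝓝 0) := by
      have := ((ht.const_sub p.1.2).abs).const_mul ((k : ℝ) + 1)
      simpa using this
    have hk0 : (0 : ℝ) < 1 / ((k : ℝ) + 1) := by positivity
    have hw2 : Tendsto (fun j => w (u j).1) atTop (𝓝 (w p.1)) := by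
      have h0 : Tendsto (fun j => w ((u j).1.1, p.1.2) - w (u j).1) atTop (𝓝 0) := by
        refine squeeze_zero_norm' ?_ hdt
        have e1 : ∀ᶠ j in atTop, ((u j).1.1, p.1.2) ∈ O :=
          (hx.prodMk_nhds tendsto_const_nhds).eventually (hO.mem_nhds hpO)
        have e2 : ∀ᶠ j in atTop, |p.1.2 - (u j).1.2| < 1 / ((k : ℝ) + 1) := by
          have := (ht.const_sub p.1.2).abs
          rw [sub_self, abs_zero] at this
          exact this.eventually (gt_mem_nhds hk0)
        filter_upwards [e1, e2] with j h1 h2 using (hu j).1 _ h1 h2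
      simpa using hw1.sub h0
    refine ⟨fun s hs hsk => ?_, fun y hy hyk => ?_⟩
    · have h1 : Tendsto (fun j => w ((u j).1.1, s)) atTop (𝓝 (w (p.1.1, s))) :=
        (hw.continuousAt_slice hs).tendsto.comp hx
      have e1 : ∀ᶠ j in atTop, ((u j).1.1, s) ∈ O :=
        (hx.prodMk_nhds tendsto_const_nhds).eventually (hO.mem_nhds hs)
      have h2 := (ht.const_sub s).abs
      refine le_of_tendsto_of_tendsto (h1.sub hw2).abs (h2.const_mul ((k : ℝ) + 1)) ?_
      filter_upwards [e1, h2.eventually (gt_mem_nhds hsk)] with j h3 h4 using (hu j).1 _ h3 h4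
    · have h1 : Tendsto (fun j => w (y, (u j).1.2)) atTop (𝓝 (w (y, p.1.2))) :=
        (hw.continuousAt_time hy).tendsto.comp ht
      have e1 : ∀ᶠ j in atTop, (y, (u j).1.2) ∈ O :=
        (tendsto_const_nhds.prodMk_nhds ht).eventually (hO.mem_nhds hy)
      have h2 := (hx.const_sub y).norm
      refine le_of_tendsto_of_tendsto (h1.sub hw2).abs (h2.const_mul ((k : ℝ) + 1)) ?_
      filter_upwards [e1, h2.eventually (gt_mem_nhds hyk)] with j h3 h4 using (hu j).2 _ h3 h4
  have hcover : ⋃ k, A k = univ := by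
    refine eq_univ_of_forall fun p => mem_iUnion.2 ?_
    obtain ⟨⟨x, t⟩, hp⟩ := p
    obtain ⟨C1, hC1⟩ := (hw _ hp.1).2.hasFDerivAt.isBigO_sub.bound
    obtain ⟨C2, hC2⟩ := ((hw _ hp.1).1.differentiableAt two_ne_zero).hasFDerivAt.isBigO_sub.bound
    obtain ⟨ε1, hε1, h1⟩ := Metric.eventually_nhds_iff.1 hC1
    obtain ⟨ε2, hε2, h2⟩ := Metric.eventually_nhds_iff.1 hC2
    obtain ⟨k1, hk1⟩ := exists_nat_one_div_lt (lt_min hε1 hε2)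
    obtain ⟨k2, hk2⟩ := exists_nat_ge (max C1 C2)
    have hle : 1 / (((max k1 k2 : ℕ) : ℝ) + 1) ≤ 1 / ((k1 : ℝ) + 1) := by
      gcongr; exact le_max_left _ _
    have hk2' : max C1 C2 ≤ ((max k1 k2 : ℕ) : ℝ) + 1 := by
      have : (k2 : ℝ) ≤ ((max k1 k2 : ℕ) : ℝ) := by gcongr; exact le_max_right _ _
      linarith
    refine ⟨max k1 k2, fun s _ hs => ?_, fun y _ hy => ?_⟩
    · refine (h1 (y := s) ?_).trans (mul_le_mul_of_nonneg_right
        ((le_max_left _ _).trans hk2') (abs_nonneg _))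
      rw [Real.dist_eq]; exact (hs.trans_le hle).trans (hk1.trans_le (min_le_left _ _))
    · refine (h2 (y := y) ?_).trans (mul_le_mul_of_nonneg_right
        ((le_max_right _ _).trans hk2') (norm_nonneg _))
      rw [dist_eq_norm]; exact (hy.trans_le hle).trans (hk1.trans_le (min_le_right _ _))
  obtain ⟨k, P, hP⟩ := nonempty_interior_of_iUnion_of_closed hclosed hcover
  obtain ⟨ε1, hε1, hball1⟩ := Metric.isOpen_iff.1 isOpen_interior P hP
  obtain ⟨ε2, hε2, hball2⟩ := Metric.isOpen_iff.1 hO P.1 P.2.1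
  have hk0 : (0 : ℝ) < 1 / ((k : ℝ) + 1) := by positivity
  set ε := min (min ε1 ε2) (1 / ((k : ℝ) + 1) / 2) with hε
  have hε0 : 0 < ε := lt_min (lt_min hε1 hε2) (half_pos hk0)
  have hεk : 2 * ε ≤ 1 / ((k : ℝ) + 1) := by
    linarith [min_le_right (min ε1 ε2) (1 / ((k : ℝ) + 1) / 2)]
  set U := Metric.ball P.1 ε with hU
  have hUO : U ⊆ O := (Metric.ball_subset_ball
    ((min_le_left _ _).trans (min_le_right _ _))).trans hball2
  have hdist : ∀ p ∈ U, ∀ q ∈ U, dist p q < 1 / ((k : ℝ) + 1) := fun p hp q hq =>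
    (dist_triangle_right p q P.1).trans_lt (by
      rw [Metric.mem_ball] at hp hq; linarith)
  have hSA : ∀ p (hp : p ∈ S), p ∈ U → (⟨p, hp⟩ : S) ∈ A k := fun p hp hpU =>
    interior_subset (hball1 (Metric.ball_subset_ball
      ((min_le_left _ _).trans (min_le_left _ _)) (show (⟨p, hp⟩ : S) ∈ Metric.ball P ε from hpU)))
  have hUS : U \ S = U ∩ G := by
    ext p; constructor
    · rintro ⟨h1, h2⟩; exact ⟨h1, by_contra fun h3 => h2 ⟨hUO h1, h3⟩⟩
    · rintro ⟨h1, h2⟩; exact ⟨h1, fun h3 => h3.2 h2⟩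
  refine P.2.2 (mem_interior.2 ⟨U, fun p hp => ⟨hUO hp, ?_⟩, Metric.isOpen_ball,
    Metric.mem_ball_self hε0⟩)
  by_cases hpS : p ∈ S
  · refine lsc_of_lipschitz_on (U := U) (S := S) Metric.isOpen_ball (fun q hq => hw q (hUO hq))
      (fun q hq => hlow q (hUO hq)) ?_ (k := (k : ℝ) + 1) (by positivity) ?_ ?_ ?_ hpS hp
    · rw [hUS]; exact Metric.isOpen_ball.inter isOpen_interior
    · intro q hq; rw [hUS] at hq; exact hGL q hq.2
    · intro x t s hxS hxU hsU
      refine (hSA _ hxS hxU).1 s (hUO hsU) ?_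
      simpa [Prod.dist_eq, Real.dist_eq] using hdist _ hsU _ hxU
    · intro x y t hxS hxU hyU
      refine (hSA _ hxS hxU).2 y (hUO hyU) ?_
      simpa [Prod.dist_eq, dist_eq_norm] using hdist _ hyU _ hxU
  · exact hGL p (by_contra fun h => hpS ⟨hUO hp, h⟩)

/-- `w` solves the heat equation above the graph of `g`, its negative part vanishes on the graph,
`w ≥ -1`, and `w ≥ f` above height `h`. -/
structure IsGraphSol {m : ℕ} (g : Spc' m → ℝ → ℝ) (r h f : ℝ) (w : Spc m × ℝ → ℝ) : Prop where
  cont : Continuous fun q : Spc' m × ℝ => g q.1 q.2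
  lt : h < r
  f_pos : 0 < f
  heat : SolvesHeat w (CylBH g r)
  vanish : VanishesOn (fun q => max (-w q) 0) (CylBH g r) (graphSet g)
  high : ∀ p ∈ CylBH g r, g (xprime p.1) p.2 + h ≤ xlast p.1 → f ≤ w p
  low : ∀ p ∈ CylBH g r, -1 ≤ w p

/-- The lateral and temporal constraints of the Hölder cylinder. -/
def slab (m : ℕ) (r : ℝ) : Set (Spc m × ℝ) :=
  {p | (∀ i : Fin m, -r < xprime p.1 i ∧ xprime p.1 i < r) ∧ -r < p.2 ∧ p.2 ≤ 0}

/-- The negative part of `w`, extended by zero outside the Hölder cylinder. -/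
def negExt {m : ℕ} (g : Spc' m → ℝ → ℝ) (r : ℝ) (w : Spc m × ℝ → ℝ) (p : Spc m × ℝ) : ℝ :=
  if p ∈ CylBH g r then max (-w p) 0 else 0

lemma continuous_xlast {m : ℕ} : Continuous (xlast : Spc m → ℝ) := by unfold xlast; fun_prop

lemma continuous_xprime {m : ℕ} : Continuous (xprime : Spc m → Spc' m) := by
  unfold xprime
  exact (PiLp.continuous_toLp 2 _).comp (by fun_prop)

lemma tendsto_time_left {m : ℕ} (p : Spc m × ℝ) :
    Tendsto (fun s => (p.1, s)) (𝓝[≤] p.2) (𝓝 p) := by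
  have : Continuous fun s : ℝ => (p.1, s) := by fun_prop
  exact (this.tendsto p.2).mono_left nhdsWithin_le_nhds

lemma tendsto_slice {m : ℕ} (p : Spc m × ℝ) : Tendsto (fun z => (z, p.2)) (𝓝 p.1) (𝓝 p) := by
  have : Continuous fun z : Spc m => (z, p.2) := by fun_prop
  exact this.tendsto p.1

namespace IsGraphSol

variable {m : ℕ} {g : Spc' m → ℝ → ℝ} {r h f : ℝ} {w : Spc m × ℝ → ℝ}

lemma continuous_graph (hg : Continuous fun q : Spc' m × ℝ => g q.1 q.2) :
    Continuous fun q : Spc m × ℝ => g (xprime q.1) q.2 :=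
  hg.comp ((continuous_xprime.comp continuous_fst).prodMk continuous_snd)

lemma eventually_mem_of_le (hs : IsGraphSol g r h f w) {p : Spc m × ℝ} (hp : p ∈ CylBH g r) :
    ∀ᶠ q in 𝓝 p, q.2 ≤ 0 → q ∈ CylBH g r := by
  have hc := continuous_graph hs.cont
  have hxl : Continuous fun q : Spc m × ℝ => xlast q.1 := continuous_xlast.comp continuous_fst
  have hxp : ∀ i, Continuous fun q : Spc m × ℝ => xprime q.1 i := fun i => by
    have := continuous_xprime.comp (continuous_fst (X := Spc m) (Y := ℝ))
    fun_prop
  obtain ⟨h1, h2, h3, h4, h5⟩ := hp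
  have e1 : ∀ᶠ q : Spc m × ℝ in 𝓝 p, ∀ i, -r < xprime q.1 i ∧ xprime q.1 i < r :=
    eventually_all.2 fun i => ((hxp i).continuousAt.eventually (lt_mem_nhds (h1 i).1)).and
      ((hxp i).continuousAt.eventually (gt_mem_nhds (h1 i).2))
  have e2 : ∀ᶠ q : Spc m × ℝ in 𝓝 p, -r < q.2 := continuous_snd.continuousAt.eventually (lt_mem_nhds h2)
  have e3 := hc.continuousAt.eventually_lt hxl.continuousAt h4
  have e4 := hxl.continuousAt.eventually_lt (hc.add continuous_const).continuousAt h5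
  filter_upwards [e1, e2, e3, e4] with q q1 q2 q3 q4 q5 using ⟨q1, q2, q5, q3, q4⟩

lemma eventually_mem_slice (hs : IsGraphSol g r h f w) {p : Spc m × ℝ} (hp : p ∈ CylBH g r) :
    ∀ᶠ z in 𝓝 p.1, (z, p.2) ∈ CylBH g r := by
  filter_upwards [(tendsto_slice p).eventually (hs.eventually_mem_of_le hp)] with z hz
    using hz hp.2.2.1

lemma eventually_mem_time (hs : IsGraphSol g r h f w) {p : Spc m × ℝ} (hp : p ∈ CylBH g r) :
    ∀ᶠ s in 𝓝[≤] p.2, (p.1, s) ∈ CylBH g r := by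
  filter_upwards [(tendsto_time_left p).eventually (hs.eventually_mem_of_le hp),
    self_mem_nhdsWithin] with s hz h2 using hz (le_trans h2 hp.2.2.1)

lemma negExt_nonneg (p : Spc m × ℝ) : 0 ≤ negExt g r w p := by
  unfold negExt; split_ifs
  · exact le_max_right _ _
  · exact le_rfl

lemma negExt_le_one (hs : IsGraphSol g r h f w) (p : Spc m × ℝ) : negExt g r w p ≤ 1 := by
  unfold negExt; split_ifs with hp
  · exact max_le (by linarith [hs.low p hp]) zero_le_one
  · exact zero_le_one

lemma of_negExt_pos {p : Spc m × ℝ} (hp : 0 < negExt g r w p) :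
    p ∈ CylBH g r ∧ negExt g r w p = -w p := by
  unfold negExt at hp ⊢
  split_ifs at hp ⊢ with h1
  · refine ⟨h1, max_eq_left (le_of_not_gt fun h2 => ?_)⟩
    rw [max_eq_right h2.le] at hp; exact lt_irrefl _ hp
  · exact absurd hp (lt_irrefl _)

lemma height_lt_of_negExt_pos (hs : IsGraphSol g r h f w) {p : Spc m × ℝ}
    (hp : 0 < negExt g r w p) : xlast p.1 < g (xprime p.1) p.2 + h := by
  obtain ⟨h1, h2⟩ := of_negExt_pos hp
  by_contra! h3
  linarith [hs.high p h1 h3, hs.f_pos]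

lemma lowerSemicontinuousWithinAt (hs : IsGraphSol g r h f w) {p : Spc m × ℝ}
    (hp : p ∈ CylBH g r) : LowerSemicontinuousWithinAt w {q | p.2 ≤ q.2 ∧ q.2 ≤ 0} p := by
  rcases lt_or_eq_of_le hp.2.2.1 with h0 | h0
  · set O := interior (CylBH g r) with hO
    have hpO : p ∈ O := by
      rw [hO, mem_interior_iff_mem_nhds]
      filter_upwards [hs.eventually_mem_of_le hp,
        continuous_snd.continuousAt.eventually (gt_mem_nhds h0)] with q h1 h2 using h1 h2.le
    exact (SolvesHeat.lowerSemicontinuousWithinAt isOpen_interior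
      (fun q hq => hs.heat q (interior_subset hq)) (fun q hq => hs.low q (interior_subset hq)) p
      hpO).mono fun q hq => hq.1
  · intro c hc
    have h1 := (hs.heat p hp).1.continuousAt.eventually (lt_mem_nhds hc)
    have h2 : Tendsto Prod.fst (𝓝[{q : Spc m × ℝ | p.2 ≤ q.2 ∧ q.2 ≤ 0}] p) (𝓝 p.1) :=
      continuous_fst.continuousAt.tendsto.mono_left nhdsWithin_le_nhds
    filter_upwards [h2.eventually h1, self_mem_nhdsWithin] with q hq1 hq2
    have h3 : q = (q.1, p.2) := Prod.ext rfl (by linarith [hq2.1, hq2.2])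
    rwa [h3]

lemma continuousAt_negExt_of_notMem (hs : IsGraphSol g r h f w) {p : Spc m × ℝ}
    (hp : p ∈ slab m r) (hpC : p ∉ CylBH g r) : ContinuousAt (negExt g r w) p := by
  have hc := continuous_graph hs.cont
  have hxl : Continuous fun q : Spc m × ℝ => xlast q.1 := continuous_xlast.comp continuous_fst
  have hV0 : negExt g r w p = 0 := if_neg hpC
  suffices H : ∀ c > 0, ∀ᶠ q in 𝓝 p, negExt g r w q < c by
    rw [ContinuousAt, hV0, tendsto_order]
    exact ⟨fun a ha => Eventually.of_forall fun q => ha.trans_le (negExt_nonneg q), H⟩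
  intro c hc0
  rcases lt_trichotomy (xlast p.1) (g (xprime p.1) p.2) with h1 | h1 | h1
  · filter_upwards [hxl.continuousAt.eventually_lt hc.continuousAt h1] with q hq
    rwa [negExt, if_neg fun h2 => lt_asymm hq h2.2.2.2.1]
  · by_cases hcl : p ∈ closure (CylBH g r)
    · have h2 := (hs.vanish p ⟨h1, hcl⟩).eventually (gt_mem_nhds hc0)
      filter_upwards [eventually_nhdsWithin_iff.1 h2] with q hq
      unfold negExt
      split_ifs with h3
      · exact hq h3
      · exact hc0
    · filter_upwards [isClosed_closure.isOpen_compl.mem_nhds hcl] with q hq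
      rwa [negExt, if_neg fun h2 => hq (subset_closure h2)]
  · have h2 : g (xprime p.1) p.2 + h < xlast p.1 := by
      by_contra! h3
      exact hpC ⟨hp.1, hp.2.1, hp.2.2, h1, by linarith [hs.lt]⟩
    filter_upwards [(hc.add continuous_const).continuousAt.eventually_lt hxl.continuousAt h2]
      with q hq
    by_contra! h3
    exact lt_asymm hq (hs.height_lt_of_negExt_pos (hc0.trans_le h3))

lemma upperSemicontinuousWithinAt_negExt (hs : IsGraphSol g r h f w) {p : Spc m × ℝ}
    (hp : p ∈ slab m r) :
    UpperSemicontinuousWithinAt (negExt g r w) {q | p.2 ≤ q.2 ∧ q.2 ≤ 0} p := by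
  by_cases hpC : p ∈ CylBH g r
  · intro c hc
    have hc0 : 0 < c := (negExt_nonneg p).trans_lt hc
    rw [negExt, if_pos hpC] at hc
    have hcw : -c < w p := by linarith [(le_max_left (-w p) 0).trans_lt hc]
    filter_upwards [hs.lowerSemicontinuousWithinAt hpC (-c) hcw] with q hq
    unfold negExt; split_ifs
    · exact max_lt (by linarith) hc0
    · exact hc0
  · exact (hs.continuousAt_negExt_of_notMem hp hpC).continuousWithinAt.upperSemicontinuousWithinAt

lemma continuousAt_negExt_slice (hs : IsGraphSol g r h f w) {p : Spc m × ℝ}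
    (hp : p ∈ slab m r) : ContinuousAt (fun z => negExt g r w (z, p.2)) p.1 := by
  by_cases hpC : p ∈ CylBH g r
  · have h1 : ContinuousAt (fun z => max (-w (z, p.2)) 0) p.1 :=
      (hs.heat p hpC).1.continuousAt.neg.max continuousAt_const
    refine h1.congr ?_
    filter_upwards [hs.eventually_mem_slice hpC] with z hz
    rw [negExt, if_pos hz]
  · exact (hs.continuousAt_negExt_of_notMem hp hpC).tendsto.comp (tendsto_slice p)

lemma slab_of_mem {p : Spc m × ℝ} (hp : p ∈ CylBH g r) : p ∈ slab m r := ⟨hp.1, hp.2.1, hp.2.2.1⟩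

lemma eventually_negExt_pos_slice (hs : IsGraphSol g r h f w) {p : Spc m × ℝ}
    (hp : 0 < negExt g r w p) : ∀ᶠ z in 𝓝 p.1, 0 < negExt g r w (z, p.2) :=
  (hs.continuousAt_negExt_slice (slab_of_mem (of_negExt_pos hp).1)).eventually (lt_mem_nhds hp)

lemma eventually_negExt_pos_time (hs : IsGraphSol g r h f w) {p : Spc m × ℝ}
    (hp : 0 < negExt g r w p) : ∀ᶠ s in 𝓝[≤] p.2, 0 < negExt g r w (p.1, s) := by
  obtain ⟨h1, h2⟩ := of_negExt_pos hp
  have h3 : w p < 0 := by linarith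
  have h4 := nhdsWithin_le_nhds (s := Iic p.2) ((hs.heat p h1).2.continuousAt.eventually
    (gt_mem_nhds h3))
  filter_upwards [h4, hs.eventually_mem_time h1] with s h5 h6
  rw [negExt, if_pos h6]
  exact lt_max_of_lt_left (by linarith)

lemma hasHeat_negExt (hs : IsGraphSol g r h f w) {p : Spc m × ℝ} (hp : 0 < negExt g r w p) :
    HasHeat (negExt g r w) p := by
  refine ((hs.heat.hasHeat (of_negExt_pos hp).1).const_mul (-1)).congr ?_ ?_
  · filter_upwards [hs.eventually_negExt_pos_slice hp] with z hz
    rw [(of_negExt_pos hz).2]; ring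
  · filter_upwards [hs.eventually_negExt_pos_time hp] with s hz
    rw [(of_negExt_pos hz).2]; ring

end IsGraphSol

/-- A lower bound for the heat kernel integrated over half of a unit cutoff at distance `D`. -/
def kerConst (m : ℕ) (D : ℝ) : ℝ :=
  min 1 ((gaussMass m)⁻¹ * Real.exp (-D ^ 2 / 4) *
    (volume.real (Metric.ball (0 : Spc m) 1) / 2))

lemma kerConst_pos (m : ℕ) (D : ℝ) : 0 < kerConst m D := by
  have h1 : 0 < volume.real (Metric.ball (0 : Spc m) 1) :=
    ENNReal.toReal_pos (Metric.measure_ball_pos _ _ one_pos).ne' measure_ball_lt_top.ne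
  have h2 := gaussMass_pos m
  unfold kerConst
  positivity

lemma kerConst_le_one (m : ℕ) (D : ℝ) : kerConst m D ≤ 1 := min_le_left _ _

section Scaled

variable {m : ℕ}

lemma le_integral_cutoff (x : Spc m) {ρ : ℝ} (hρ : 0 < ρ) :
    ρ ^ (m + 1) * volume.real (Metric.ball (0 : Spc m) 1) ≤ ∫ z, cutoff x ρ z := by
  have h1 : volume.real (Metric.closedBall x ρ) =
      ρ ^ (m + 1) * volume.real (Metric.ball (0 : Spc m) 1) := by
    rw [measureReal_def, Measure.addHaar_closedBall _ _ hρ.le, ENNReal.toReal_mul,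
      ENNReal.toReal_ofReal (by positivity)]
    simp [measureReal_def]
  rw [← h1, ← integral_indicator_one Metric.isClosed_closedBall.measurableSet]
  refine integral_mono ?_ ?_ fun z => ?_
  · exact (integrable_indicator_iff Metric.isClosed_closedBall.measurableSet).2
      (integrableOn_const (isCompact_closedBall x ρ).measure_lt_top.ne)
  · exact continuous_cutoff.integrable_of_hasCompactSupport (hasCompactSupport_cutoff hρ)
  · by_cases hz : z ∈ Metric.closedBall x ρ
    · rw [indicator_of_mem hz, cutoff_eq_one hρ (by simpa [dist_eq_norm] using hz)]; rfl
    · rw [indicator_of_notMem hz]; exact clamp_nonneg _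

lemma kerConst_le_heatExt {θ : Spc m → ℝ} (hθ : Continuous θ) (hθc : HasCompactSupport θ)
    (h0 : ∀ z, 0 ≤ θ z) {ρ D : ℝ} (hρ : 0 < ρ) (x y : Spc m)
    (hint : (∫ z, cutoff x ρ z) / 2 ≤ ∫ z, θ z) (hD : ∀ z, θ z ≠ 0 → ‖y - z‖ ≤ D * ρ) :
    kerConst m D ≤ heatExt θ (y, ρ ^ 2) := by
  refine le_trans ?_ (le_heatExt hθ hθc h0 y (pow_pos hρ 2) hD)
  refine (min_le_right _ _).trans ?_
  have hker : heatKer m (ρ ^ 2) ((D * ρ) ^ 2) = Real.exp (-D ^ 2 / 4) * (ρ ^ (m + 1))⁻¹ := by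
    have : ρ ^ (m + 1) = Real.exp ((m + 1) / 2 * Real.log (ρ ^ 2)) := by
      conv_lhs => rw [← Real.exp_log hρ]
      rw [← Real.exp_nat_mul, Real.log_pow]
      congr 1; push_cast; ring
    rw [this, ← Real.exp_neg, ← Real.exp_add, heatKer]
    congr 1; field_simp; ring
  rw [hker]
  have h1 : ρ ^ (m + 1) * volume.real (Metric.ball (0 : Spc m) 1) / 2 ≤ ∫ z, θ z := by
    linarith [le_integral_cutoff x hρ]
  have hg := gaussMass_pos m
  have hρp : 0 < ρ ^ (m + 1) := by positivity
  calc _ = (gaussMass m)⁻¹ * (Real.exp (-D ^ 2 / 4) * (ρ ^ (m + 1))⁻¹) *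
        (ρ ^ (m + 1) * volume.real (Metric.ball (0 : Spc m) 1) / 2) := by field_simp
    _ ≤ _ := by gcongr

end Scaled

namespace IsGraphSol

variable {m : ℕ} {g : Spc' m → ℝ → ℝ} {r h f : ℝ} {w : Spc m × ℝ → ℝ}

/-- One step of the chain of comparisons: a lower bound on a translate of the support of `θ`
propagates forward in time through the region where the negative part is positive. -/
lemma chain_step (hs : IsGraphSol g r h f w) {x ω : Spc m} {v : Spc m × ℝ} {τ R σ c F ρ : ℝ}
    {θ : Spc m → ℝ} (hρ : 0 < ρ) (hR : 0 < R) (hσ : 0 < σ) (hF : 0 < F) (hc : c ≤ 1)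
    (hθ : Continuous θ)
    (hθc : HasCompactSupport θ) (h0 : ∀ z, 0 ≤ θ z) (h1 : ∀ z, θ z ≤ 1)
    (hsupp : ∀ z, θ z ≠ 0 → z ∈ Metric.closedBall x R)
    (hV : ∀ z, θ z ≠ 0 → σ * (1 - c / 4) < negExt g r w (z, τ))
    (hker : ∀ z, θ z ≠ 0 → c ≤ heatExt (fun y => θ (y - ω)) (z, ρ ^ 2))
    (hbar : ∀ z, θ z ≠ 0 → latBar x R (τ - ρ ^ 2) (z, τ) ≤ c / 4)
    (hslab : Metric.closedBall x R ×ˢ Icc (τ - ρ ^ 2) τ ⊆ slab m r)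
    (hVσ : ∀ p ∈ Metric.closedBall x R ×ˢ Icc (τ - ρ ^ 2) τ, negExt g r w p ≤ σ)
    (hshift : ∀ p ∈ Metric.closedBall x R ×ˢ Icc (τ - ρ ^ 2) τ, 0 < negExt g r w p →
      p + v ∈ CylBH g r) (hv : v.2 ≤ 0)
    (hprev : ∀ z, θ z ≠ 0 → F - 1 ≤ w ((z + ω, τ - ρ ^ 2) + v)) :
    ∀ z, θ z ≠ 0 → F * (c / 2) - 1 ≤ w ((z, τ) + v) := by
  set a := τ - ρ ^ 2 with ha
  have haτ : a ≤ τ := by rw [ha]; linarith [pow_pos hρ 2]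
  set θ' : Spc m → ℝ := fun y => θ (y - ω) with hθ'
  have hθ'c : Continuous θ' := by fun_prop
  have hθ's : HasCompactSupport θ' := by
    simpa [hθ', sub_eq_add_neg, Function.comp_def] using
      hθc.comp_homeomorph (Homeomorph.addRight (-ω))
  have h0' : ∀ y, 0 ≤ θ' y := fun y => h0 _
  have h1' : ∀ y, θ' y ≤ 1 := fun y => h1 _
  set V := negExt g r w with hVdef
  set B : Spc m × ℝ → ℝ := fun q => 1 + (F + (F * latBar x R a q +
    (-F) * heatExt θ' (q.1, q.2 - a))) with hB
  set Φ : Spc m × ℝ → ℝ := fun q => w (q + v) + ((-(F / σ)) * V q + B q) with hΦ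
  set Ψ : Spc m × ℝ → ℝ := fun q => if 0 < V q then Φ q else 1 with hΨ
  have hBc : Continuous B := by
    have := continuous_heatExt hθ'c h0' h1'
    have := continuous_latBar x R a
    fun_prop
  have hH1 : ∀ q, F * heatExt θ' q ≤ F := fun q =>
    mul_le_of_le_one_right hF.le (heatExt_le_one hθ'c h0' h1' q)
  have hFV : ∀ p ∈ Metric.closedBall x R ×ˢ Icc a τ, F / σ * V p ≤ F := fun p hp => by
    rw [div_mul_eq_mul_div, div_le_iff₀ hσ]
    exact mul_le_mul_of_nonneg_left (hVσ p hp) hF.le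
  have hmp := minimum_principle Ψ x R a τ ?_ ?_ ?_ ?_
  · intro z hz
    have hzm : (z, τ) ∈ Metric.closedBall x R ×ˢ Icc a τ := ⟨hsupp z hz, haτ, le_rfl⟩
    have hVz := hV z hz
    have hpos : 0 < V (z, τ) := lt_of_le_of_lt (by
      have : 0 ≤ 1 - c / 4 := by linarith
      positivity) hVz
    have h2 := hmp (z, τ) hzm
    simp only [hΨ, if_pos hpos, hΦ, hB, ha, sub_sub_cancel] at h2
    have e1 := mul_le_mul_of_nonneg_left (hker z hz) hF.le
    have e2 := mul_le_mul_of_nonneg_left (hbar z hz) hF.le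
    have e3 : F * (1 - c / 4) ≤ F / σ * V (z, τ) := by
      rw [div_mul_eq_mul_div, le_div_iff₀ hσ]
      calc F * (1 - c / 4) * σ = F * (σ * (1 - c / 4)) := by ring
        _ ≤ _ := mul_le_mul_of_nonneg_left hVz.le hF.le
    simp only [ha] at e2
    linarith
  · intro y hy
    have hym : (y, a) ∈ Metric.closedBall x R ×ˢ Icc a τ := ⟨hy, le_rfl, haτ⟩
    simp only [hΨ]
    split_ifs with hpos
    · have e1 := hFV _ hym
      have e2 := mul_nonneg hF.le (latBar_nonneg (x0 := x) (R := R) (p := (y, a)) le_rfl)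
      have e3 := hs.low _ (hshift _ hym hpos)
      simp only [hΦ, hB, sub_self, heatExt_zero]
      by_cases hz : θ' y = 0
      · rw [hz]; linarith
      · have e4 := hprev (y - ω) hz
        rw [sub_add_cancel] at e4
        have e5 := mul_le_of_le_one_right hF.le (h1' y)
        linarith
    · exact zero_le_one
  · intro y t hy ht
    have hym : (y, t) ∈ Metric.closedBall x R ×ˢ Icc a τ := ⟨by simp [dist_eq_norm, hy], ht⟩
    simp only [hΨ]
    split_ifs with hpos
    · have e1 := hFV _ hym
      have e2 := mul_le_mul_of_nonneg_left (one_le_latBar hR hy ht.1) hF.le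
      have e3 := hs.low _ (hshift _ hym hpos)
      have e4 := hH1 (y, t - a)
      simp only [hΦ, hB]; linarith
    · exact zero_le_one
  · intro p hp c' hc' hlt
    have hps := hslab hp
    have hsub : {q | q ∈ Metric.closedBall x R ×ˢ Icc a τ ∧ p.2 ≤ q.2} ⊆
        {q | p.2 ≤ q.2 ∧ q.2 ≤ 0} := fun q hq => ⟨hq.2, (hslab hq.1).2.2⟩
    have hVu := (hs.upperSemicontinuousWithinAt_negExt hps).mono hsub
    by_cases hpos : 0 < V p
    · simp only [hΨ, if_pos hpos] at hlt
      have l1 : LowerSemicontinuousWithinAt (fun q => w (q + v))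
          {q | q ∈ Metric.closedBall x R ×ˢ Icc a τ ∧ p.2 ≤ q.2} p := by
        intro b hb
        have h2 := hs.lowerSemicontinuousWithinAt (hshift p hp hpos) b hb
        have h3 : Tendsto (fun q => q + v)
            (𝓝[{q | q ∈ Metric.closedBall x R ×ˢ Icc a τ ∧ p.2 ≤ q.2}] p)
            (𝓝[{q | (p + v).2 ≤ q.2 ∧ q.2 ≤ 0}] (p + v)) := by
          refine tendsto_nhdsWithin_iff.2 ⟨?_, ?_⟩
          · exact ((continuous_add_const v).tendsto p).mono_left nhdsWithin_le_nhds
          · filter_upwards [self_mem_nhdsWithin] with q hq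
            exact ⟨add_le_add_left hq.2 v.2, add_nonpos (hslab hq.1).2.2 hv⟩
        exact h3.eventually h2
      have l2 : LowerSemicontinuousWithinAt (fun q => (-(F / σ)) * V q)
          {q | q ∈ Metric.closedBall x R ×ˢ Icc a τ ∧ p.2 ≤ q.2} p := by
        intro b hb
        have hq0 : 0 < F / σ := div_pos hF hσ
        have hb' : V p < -b / (F / σ) := by rw [lt_div_iff₀ hq0]; linarith
        filter_upwards [hVu _ hb'] with q hq
        rw [lt_div_iff₀ hq0] at hq; linarith
      have l3 := l1.add (l2.add hBc.continuousWithinAt.lowerSemicontinuousWithinAt)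
      filter_upwards [l3 c' hlt] with q hq
      simp only [hΨ]; split_ifs
      · exact hq
      · linarith
    · have hV0 : V p < -c' / (F / σ) :=
        (not_lt.1 hpos).trans_lt (div_pos (by linarith) (div_pos hF hσ))
      filter_upwards [hVu _ hV0, self_mem_nhdsWithin] with q hq hqm
      simp only [hΨ]; split_ifs with hqpos
      · rw [lt_div_iff₀ (div_pos hF hσ)] at hq
        have e2 := mul_nonneg hF.le (latBar_nonneg (x0 := x) (R := R) (p := q) hqm.1.2.1)
        have e3 := hs.low _ (hshift _ hqm.1 hqpos)
        have e4 := hH1 (q.1, q.2 - a)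
        simp only [hΦ, hB]; linarith
      · linarith
  · intro y t hy ht hts hneg
    have hym : (y, t) ∈ Metric.closedBall x R ×ˢ Icc a τ :=
      ⟨by simpa [dist_eq_norm] using hy.le, ht.le, hts⟩
    have hpos : 0 < V (y, t) := by
      by_contra hcon
      simp only [hΨ, if_neg hcon] at hneg; linarith
    have hΦh : HasHeat Φ (y, t) := ((hs.heat.hasHeat (hshift _ hym hpos)).translate v).add
      (((hs.hasHeat_negExt hpos).const_mul _).add ((hasHeat_const _).add ((hasHeat_const _).add
        (((hasHeat_latBar _).const_mul F).add ((hasHeat_heatExt hθ'c hθ's ht).const_mul (-F))))))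
    refine hΦh.congr ?_ ?_
    · filter_upwards [hs.eventually_negExt_pos_slice hpos] with z hz
      simp only [hΨ]; exact if_pos hz
    · filter_upwards [hs.eventually_negExt_pos_time hpos] with s hz
      simp only [hΨ]; exact if_pos hz

/-- If the negative part is at most `σ (1 - η θ)` initially and at most `σ` throughout, then it
decreases according to the heat extension of `θ`. -/
lemma decay_of_initial (hs : IsGraphSol g r h f w) {x : Spc m} {τ t R σ η : ℝ}
    {θ : Spc m → ℝ} (hR : 0 < R) (hσ : 0 < σ) (hη : 0 < η) (hη1 : η < 1) (hτt : τ ≤ t)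
    (hθ : Continuous θ) (hθc : HasCompactSupport θ) (h0 : ∀ z, 0 ≤ θ z) (h1 : ∀ z, θ z ≤ 1)
    (hslab : Metric.closedBall x R ×ˢ Icc τ t ⊆ slab m r)
    (hVσ : ∀ p ∈ Metric.closedBall x R ×ˢ Icc τ t, negExt g r w p ≤ σ)
    (hinit : ∀ z ∈ Metric.closedBall x R, negExt g r w (z, τ) ≤ σ * (1 - η * θ z)) :
    negExt g r w (x, t) ≤ σ * (1 - η * heatExt θ (x, t - τ) + η * latBar x R τ (x, t)) := by
  set V := negExt g r w with hVdef
  set B : Spc m × ℝ → ℝ := fun q => σ + ((σ * η) * latBar x R τ q +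
    (-(σ * η)) * heatExt θ (q.1, q.2 - τ)) with hB
  have hση : 0 < σ * η := mul_pos hσ hη
  have hBc : Continuous B := by
    have := continuous_heatExt hθ h0 h1
    have := continuous_latBar x R τ
    fun_prop
  have hH1 : ∀ q, (σ * η) * heatExt θ q ≤ σ * η := fun q =>
    mul_le_of_le_one_right hση.le (heatExt_le_one hθ h0 h1 q)
  have hση1 : σ * η < σ := mul_lt_of_lt_one_right hσ hη1
  have hmp := minimum_principle (fun q => B q + (-1) * V q) x R τ t ?_ ?_ ?_ ?_ (x, t)
    ⟨Metric.mem_closedBall_self hR.le, hτt, le_rfl⟩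
  · simp only [hB] at hmp; linarith
  · intro y hy
    have e1 := hinit y hy
    have e2 := mul_nonneg hση.le (latBar_nonneg (x0 := x) (R := R) (p := (y, τ)) le_rfl)
    simp only [hB, sub_self, heatExt_zero]; linarith
  · intro y s hy hsm
    have e1 := hVσ (y, s) ⟨by simp [dist_eq_norm, hy], hsm⟩
    have e2 := mul_le_mul_of_nonneg_left (one_le_latBar hR hy hsm.1) hση.le
    have e3 := hH1 (y, s - τ)
    simp only [hB]; linarith
  · intro p hp c _ hc
    have hVu := (hs.upperSemicontinuousWithinAt_negExt (hslab hp)).mono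
      (show {q | q ∈ Metric.closedBall x R ×ˢ Icc τ t ∧ p.2 ≤ q.2} ⊆
        {q | p.2 ≤ q.2 ∧ q.2 ≤ 0} from fun q hq => ⟨hq.2, (hslab hq.1).2.2⟩)
    have l2 : LowerSemicontinuousWithinAt (fun q => (-1) * V q)
        {q | q ∈ Metric.closedBall x R ×ˢ Icc τ t ∧ p.2 ≤ q.2} p := by
      intro b hb
      filter_upwards [hVu (-b) (by linarith)] with q hq
      linarith
    exact (hBc.continuousWithinAt.lowerSemicontinuousWithinAt.add l2) c hc
  · intro y s hy hs1 hs2 hneg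
    have e2 := mul_nonneg hση.le (latBar_nonneg (x0 := x) (R := R) (p := (y, s)) hs1.le)
    have e3 := hH1 (y, s - τ)
    have hpos : 0 < V (y, s) := by simp only [hB] at hneg; linarith
    exact ((hasHeat_const _).add (((hasHeat_latBar _).const_mul _).add
      ((hasHeat_heatExt hθ hθc hs1).const_mul _))).add ((hs.hasHeat_negExt hpos).const_mul _)

end IsGraphSol

namespace IsGraphSol

variable {m : ℕ} {g : Spc' m → ℝ → ℝ} {r h f : ℝ} {w : Spc m × ℝ → ℝ}

/-- A chain of `J` comparisons, moving by `ω` and backward by `ρ ^ 2` each time, shows that `w` is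
nonnegative on the support of `θ` at time `τ`. -/
lemma nonneg_of_chain (hs : IsGraphSol g r h f w) {x ω : Spc m} {τ R σ c ρ : ℝ} {J : ℕ}
    {θ : Spc m → ℝ} (hρ : 0 < ρ) (hR : 0 < R) (hσ : 0 < σ) (hc0 : 0 < c) (hc : c ≤ 1)
    (hθ : Continuous θ)
    (hθc : HasCompactSupport θ) (h0 : ∀ z, 0 ≤ θ z) (h1 : ∀ z, θ z ≤ 1)
    (hsupp : ∀ z, θ z ≠ 0 → z ∈ Metric.closedBall x R)
    (hV : ∀ z, θ z ≠ 0 → σ * (1 - c / 4) < negExt g r w (z, τ))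
    (hker : ∀ z, θ z ≠ 0 → c ≤ heatExt (fun y => θ (y - ω)) (z, ρ ^ 2))
    (hbar : ∀ z, θ z ≠ 0 → latBar x R (τ - ρ ^ 2) (z, τ) ≤ c / 4)
    (hslab : Metric.closedBall x R ×ˢ Icc (τ - ρ ^ 2) τ ⊆ slab m r)
    (hVσ : ∀ p ∈ Metric.closedBall x R ×ˢ Icc (τ - ρ ^ 2) τ, negExt g r w p ≤ σ)
    (hshift : ∀ j ≤ J, ∀ p ∈ Metric.closedBall x R ×ˢ Icc (τ - ρ ^ 2) τ, 0 < negExt g r w p →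
      p + ((j : ℝ) • ω, -(j * ρ ^ 2)) ∈ CylBH g r)
    (htop : ∀ p ∈ Metric.closedBall x R ×ˢ Icc (τ - ρ ^ 2) τ, 0 < negExt g r w p →
      f ≤ w (p + ((J : ℝ) • ω, -(J * ρ ^ 2))))
    (hf : 1 ≤ f * (c / 2) ^ J) (z : Spc m) (hz : θ z ≠ 0) : 0 ≤ w (z, τ) := by
  have hρ2 := pow_pos hρ 2
  have hkey : ∀ k j : ℕ, j + k = J → ∀ z, θ z ≠ 0 →
      f * (c / 2) ^ k - 1 ≤ w ((z, τ) + ((j : ℝ) • ω, -(j * ρ ^ 2))) := by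
    intro k
    induction k with
    | zero =>
      intro j hj z hz
      have hpos : 0 < negExt g r w (z, τ) := lt_of_le_of_lt (by
        have : 0 ≤ 1 - c / 4 := by linarith
        positivity) (hV z hz)
      have := htop (z, τ) ⟨hsupp z hz, by linarith, le_rfl⟩ hpos
      rw [← hj] at this
      simp only [add_zero] at this
      simp only [pow_zero]; linarith
    | succ k ih =>
      intro j hj
      have := hs.chain_step (v := ((j : ℝ) • ω, -(j * ρ ^ 2))) (F := f * (c / 2) ^ k) hρ hR hσ
        (mul_pos hs.f_pos (pow_pos (by linarith) k)) hc hθ hθc h0 h1 hsupp hV hker hbar hslab hVσ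
        (hshift j (by omega)) (by simp; positivity) ?_
      · intro z hz
        have := this z hz
        rw [pow_succ, ← mul_assoc]; exact this
      · intro z hz
        have h2 := ih (j + 1) (by omega) z hz
        convert h2 using 2
        ext1
        · simp [add_smul]; abel
        · simp; ring
  have := hkey J 0 (by simp) z hz
  simp only [Nat.cast_zero, zero_smul, zero_mul, neg_zero] at this
  rw [show (((0 : Spc m), (0 : ℝ))) = 0 from rfl, add_zero] at this
  linarith

/-- One step of the decay of the negative part. -/
lemma decay_step (hs : IsGraphSol g r h f w) {x ω : Spc m} {t σ c ρ D L : ℝ} {J : ℕ}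
    (hρ : 0 < ρ) (hσ : 0 < σ) (hL : 2 ≤ L) (hc0 : 0 < c) (hc : c ≤ kerConst m D)
    (hD : 4 * ρ + ‖ω‖ ≤ D * ρ) (hcL : (4 + 2 * (m + 1)) / L ^ 2 ≤ c / 4)
    (hslab : Metric.closedBall x (L * ρ) ×ˢ Icc (t - 2 * ρ ^ 2) t ⊆ slab m r)
    (hVσ : ∀ p ∈ Metric.closedBall x (L * ρ) ×ˢ Icc (t - 2 * ρ ^ 2) t, negExt g r w p ≤ σ)
    (hshift : ∀ j ≤ J, ∀ p ∈ Metric.closedBall x (L * ρ) ×ˢ Icc (t - 2 * ρ ^ 2) t,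
      0 < negExt g r w p → p + ((j : ℝ) • ω, -(j * ρ ^ 2)) ∈ CylBH g r)
    (htop : ∀ p ∈ Metric.closedBall x (L * ρ) ×ˢ Icc (t - 2 * ρ ^ 2) t, 0 < negExt g r w p →
      f ≤ w (p + ((J : ℝ) • ω, -(J * ρ ^ 2))))
    (hf : 1 ≤ f * (c / 2) ^ J) : negExt g r w (x, t) ≤ σ * (1 - c ^ 2 / 16) := by
  have hc1 : c ≤ 1 := hc.trans (kerConst_le_one m D)
  have hρ2 := pow_pos hρ 2
  have hR : 0 < L * ρ := by positivity
  have hR2 : 2 * ρ ≤ L * ρ := by gcongr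
  set V := negExt g r w with hVdef
  set τ := t - ρ ^ 2 with hτ
  set lam : Spc m → ℝ := fun z => clamp ((V (z, τ) / σ - (1 - c / 4)) / (c / 8)) with hlam
  set θR : Spc m → ℝ := fun z => cutoff x ρ z * lam z with hθR
  set θZ : Spc m → ℝ := fun z => cutoff x ρ z * (1 - lam z) with hθZ
  have hcut0 : ∀ z, 0 ≤ cutoff x ρ z := fun z => clamp_nonneg _
  have hcut1 : ∀ z, cutoff x ρ z ≤ 1 := fun z => clamp_le_one _
  have hl0 : ∀ z, 0 ≤ lam z := fun z => clamp_nonneg _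
  have hl1 : ∀ z, lam z ≤ 1 := fun z => clamp_le_one _
  have hlc : ∀ z ∈ Metric.closedBall x (2 * ρ), ContinuousAt lam z := by
    intro z hz
    have hzs : (z, τ) ∈ slab m r := hslab ⟨Metric.closedBall_subset_closedBall hR2 hz,
      by rw [hτ]; linarith, by rw [hτ]; linarith⟩
    exact continuous_clamp.continuousAt.comp
      ((((hs.continuousAt_negExt_slice hzs).div_const σ).sub continuousAt_const).div_const _)
  have hRc : Continuous θR := continuous_cutoff_mul hρ hlc
  have hZc : Continuous θZ := continuous_cutoff_mul hρ fun z hz => continuousAt_const.sub (hlc z hz)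
  have hRs : HasCompactSupport θR := (hasCompactSupport_cutoff hρ).mul_right
  have hZs : HasCompactSupport θZ := (hasCompactSupport_cutoff hρ).mul_right
  have hR0 : ∀ z, 0 ≤ θR z := fun z => mul_nonneg (hcut0 z) (hl0 z)
  have hR1 : ∀ z, θR z ≤ 1 := fun z => mul_le_one₀ (hcut1 z) (hl0 z) (hl1 z)
  have hZ0 : ∀ z, 0 ≤ θZ z := fun z => mul_nonneg (hcut0 z) (by linarith [hl1 z])
  have hZ1 : ∀ z, θZ z ≤ 1 := fun z =>
    mul_le_one₀ (hcut1 z) (by linarith [hl1 z]) (by linarith [hl0 z])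
  have hsum : (∫ z, θR z) + ∫ z, θZ z = ∫ z, cutoff x ρ z := by
    rw [← integral_add (hRc.integrable_of_hasCompactSupport hRs)
      (hZc.integrable_of_hasCompactSupport hZs)]
    congr 1; ext z; simp only [hθR, hθZ]; ring
  have hRsupp : ∀ z, θR z ≠ 0 → ‖z - x‖ ≤ 2 * ρ := fun z hz =>
    norm_le_of_cutoff_ne_zero hρ (left_ne_zero_of_mul hz)
  have hZsupp : ∀ z, θZ z ≠ 0 → ‖z - x‖ ≤ 2 * ρ := fun z hz =>
    norm_le_of_cutoff_ne_zero hρ (left_ne_zero_of_mul hz)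
  have hDρ : 4 * ρ ≤ D * ρ := by linarith [norm_nonneg ω]
  have hbound : ∀ s, s ≤ 4 * ρ ^ 2 →
      (s + 2 * (m + 1) * ρ ^ 2) / (L * ρ) ^ 2 ≤ c / 4 := fun s hs' => by
    refine le_trans ?_ hcL
    rw [mul_pow, div_le_div_iff₀ (by positivity) (by positivity)]
    nlinarith [mul_le_mul_of_nonneg_right hs' (sq_nonneg L)]
  rcases le_or_gt ((∫ z, cutoff x ρ z) / 2) (∫ z, θZ z) with hcase | hcase
  · have hh := kerConst_le_heatExt hZc hZs hZ0 hρ x x hcase (D := D) fun z hz => by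
      rw [norm_sub_rev]; linarith [hZsupp z hz]
    have hd := hs.decay_of_initial (x := x) (τ := τ) (t := t) (η := c / 8) hR hσ (by positivity)
      (by linarith) (by rw [hτ]; linarith) hZc hZs hZ0 hZ1
      (fun p hp => hslab ⟨hp.1, by have := hp.2.1; rw [hτ] at this; linarith, hp.2.2⟩)
      (fun p hp => hVσ p ⟨hp.1, by have := hp.2.1; rw [hτ] at this; linarith, hp.2.2⟩) ?_
    · have hb : latBar x (L * ρ) τ (x, t) ≤ c / 4 := by
        have := hbound 0 (by positivity)
        simpa [latBar, hτ] using this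
      rw [show t - τ = ρ ^ 2 by rw [hτ]; ring] at hd
      refine hd.trans (mul_le_mul_of_nonneg_left ?_ hσ.le)
      nlinarith [hc.trans hh]
    · intro z hz
      have hVz := hVσ (z, τ) ⟨hz, by rw [hτ]; linarith, by rw [hτ]; linarith⟩
      by_cases hlz : V (z, τ) / σ ≤ 1 - c / 8
      · rw [div_le_iff₀ hσ] at hlz
        have := mul_le_of_le_one_right (show 0 ≤ σ * (c / 8) by positivity) (hZ1 z)
        linarith
      · have : lam z = 1 := clamp_of_one_le (by
          rw [one_le_div (by positivity)]; linarith)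
        simp only [hθZ, this, sub_self, mul_zero, sub_zero, mul_one]
        exact hVz
  · exfalso
    have hRint : (∫ z, cutoff x ρ z) / 2 ≤ ∫ z, θR z := by linarith
    have hpos : 0 < ∫ z, cutoff x ρ z := by
      have h3 : 0 < volume.real (Metric.ball (0 : Spc m) 1) :=
        ENNReal.toReal_pos (Metric.measure_ball_pos _ _ one_pos).ne' measure_ball_lt_top.ne
      exact lt_of_lt_of_le (by positivity) (le_integral_cutoff x hρ)
    obtain ⟨z, hz⟩ : ∃ z, θR z ≠ 0 := by
      by_contra! hcon
      have : (∫ z, θR z) = 0 := by simp [hcon]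
      linarith
    have hVR : ∀ z, θR z ≠ 0 → σ * (1 - c / 4) < V (z, τ) := fun z hz => by
      by_contra! hcon
      refine right_ne_zero_of_mul hz (clamp_of_nonpos ?_)
      refine div_nonpos_of_nonpos_of_nonneg ?_ (by positivity)
      rw [sub_nonpos, div_le_iff₀ hσ]; linarith
    have hmem : Metric.closedBall x (L * ρ) ×ˢ Icc (τ - ρ ^ 2) τ ⊆
        Metric.closedBall x (L * ρ) ×ˢ Icc (t - 2 * ρ ^ 2) t := by
      refine prod_mono le_rfl (Icc_subset_Icc ?_ ?_) <;> rw [hτ] <;> linarith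
    have hw := hs.nonneg_of_chain (ω := ω) hρ hR hσ hc0 hc1 hRc hRs hR0 hR1
      (fun z hz => mem_closedBall_iff_norm.2 ((hRsupp z hz).trans hR2)) hVR ?_ ?_
      (hmem.trans hslab) (fun p hp => hVσ p (hmem hp)) (fun j hj p hp => hshift j hj p (hmem hp))
      (fun p hp => htop p (hmem hp)) hf z hz
    · have h4 : 0 < V (z, τ) := lt_of_le_of_lt (by
        have : 0 ≤ 1 - c / 4 := by linarith
        positivity) (hVR z hz)
      have := (of_negExt_pos h4).2
      rw [← hVdef] at this
      linarith
    · intro z hz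
      refine hc.trans (kerConst_le_heatExt (by fun_prop) ?_ (fun y => hR0 _) hρ x z ?_ ?_)
      · simpa [sub_eq_add_neg, Function.comp_def] using
          hRs.comp_homeomorph (Homeomorph.addRight (-ω))
      · rw [integral_sub_right_eq_self θR ω]; exact hRint
      · intro y hy
        have e1 := hRsupp z hz
        have e2 := hRsupp _ hy
        calc ‖z - y‖ = ‖(z - x) - (y - ω - x) - ω‖ := by congr 1; abel
          _ ≤ ‖z - x‖ + ‖y - ω - x‖ + ‖ω‖ := (norm_sub_le _ _).trans (by gcongr; exact norm_sub_le _ _)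
          _ ≤ D * ρ := by linarith
    · intro z hz
      have e1 := hRsupp z hz
      have := hbound (‖z - x‖ ^ 2) (by nlinarith [norm_nonneg (z - x)])
      simpa [latBar] using this

end IsGraphSol

lemma xlast_add_smul_eVec {m : ℕ} (y : Spc m) (s : ℝ) :
    xlast (y + s • eVec m (Fin.last m)) = xlast y + s := by
  simp [xlast, eVec]

lemma xprime_add_smul_eVec {m : ℕ} (y : Spc m) (s : ℝ) :
    xprime (y + s • eVec m (Fin.last m)) = xprime y := by
  have h : ∀ i : Fin m, i.castSucc ≠ Fin.last m := fun i => (Fin.castSucc_lt_last i).ne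
  simp [xprime, eVec, h]

lemma abs_xprime_sub_le {m : ℕ} (x y : Spc m) (i : Fin m) :
    |xprime y i - xprime x i| ≤ ‖y - x‖ := by
  simpa [xprime] using PiLp.norm_apply_le (y - x) i.castSucc

namespace IsGraphSol

variable {m : ℕ} {g : Spc' m → ℝ → ℝ} {r h f α K ρ : ℝ} {w : Spc m × ℝ → ℝ} {J : ℕ}

/-- The one-sided condition on `g` controls its variation over `j` backward steps. -/
lemma graph_back_le (hK : 0 ≤ K) (hρ : 0 < ρ)
    (hone : ∀ (x' : Spc' m) (t s : ℝ), 0 ≤ s →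
      -(K * s ^ ((1 : ℝ) / 2)) ≤ g x' (t + s) - g x' t) (x' : Spc' m) (t : ℝ) (j : ℕ) :
    g x' (t - j * ρ ^ 2) ≤ g x' t + K * (j * ρ) := by
  have h1 := hone x' (t - j * ρ ^ 2) (j * ρ ^ 2) (by positivity)
  rw [sub_add_cancel, ← Real.sqrt_eq_rpow, Real.sqrt_mul (by positivity), Real.sqrt_sq hρ.le] at h1
  have h2 : Real.sqrt j ≤ j := by
    rw [Real.sqrt_le_left (by positivity)]
    exact_mod_cast Nat.le_self_pow two_ne_zero j
  have h3 : K * (Real.sqrt j * ρ) ≤ K * (j * ρ) := by gcongr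
  linarith

/-- Points where the negative part is positive stay in the cylinder when moved up and backward. -/
lemma shift_mem (hs : IsGraphSol g r h f w) (hα : 0 < α) (hK : 0 < K) (hρ : 0 < ρ)
    (hh : ρ ^ α = h) (hhol : HolderSemi α (α / (1 + α)) K g)
    (hone : ∀ (x' : Spc' m) (t s : ℝ), 0 ≤ s →
      -(K * s ^ ((1 : ℝ) / 2)) ≤ g x' (t + s) - g x' t)
    (hJ : J * ρ ≤ (1 / K + 1) * h) (hr : (4 + 3 * K) * h ≤ r) {j : ℕ} (hj : j ≤ J)
    {p : Spc m × ℝ} (hp : 0 < negExt g r w p) (ht : -r < p.2 - j * ρ ^ 2) :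
    p + ((j : ℝ) • (2 * K * ρ) • eVec m (Fin.last m), -(j * ρ ^ 2)) ∈ CylBH g r := by
  have hjJ : (j : ℝ) * ρ ≤ J * ρ := by gcongr
  obtain ⟨⟨h1, h2, h3, h4, h5⟩, -⟩ := of_negExt_pos hp
  have hlow := hs.height_lt_of_negExt_pos hp
  have hh0 : 0 < h := hh ▸ Real.rpow_pos_of_pos hρ α
  have hA : 1 ≤ 1 / K + 1 := by
    have : 0 ≤ 1 / K := by positivity
    linarith
  have hK1 : K * ((1 / K + 1) * h) = (1 + K) * h := by field_simp
  have hpow : (j * ρ ^ 2) ^ (α / (1 + α)) ≤ (1 / K + 1) * h := by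
    have e1 : (ρ * h) ^ (α / (1 + α)) = h := by
      have : ρ * h = ρ ^ (1 + α) := by rw [Real.rpow_add hρ, Real.rpow_one, hh]
      rw [this, ← Real.rpow_mul hρ.le, mul_div_cancel₀ _ (by positivity), hh]
    calc (j * ρ ^ 2) ^ (α / (1 + α)) ≤ ((1 / K + 1) * (ρ * h)) ^ (α / (1 + α)) := by
          apply Real.rpow_le_rpow (by positivity) _ (by positivity)
          nlinarith
      _ = (1 / K + 1) ^ (α / (1 + α)) * h := by
          rw [Real.mul_rpow (by positivity) (by positivity), e1]
      _ ≤ (1 / K + 1) * h := by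
          gcongr
          exact Real.rpow_le_self_of_one_le hA (by rw [div_le_one (by positivity)]; linarith)
  have hgt : g (xprime p.1) p.2 ≤ g (xprime p.1) (p.2 - j * ρ ^ 2) + (1 + K) * h := by
    have e1 := (abs_le.1 (hhol (xprime p.1) (xprime p.1) p.2 (p.2 - j * ρ ^ 2))).2
    rw [sub_self, norm_zero, Real.zero_rpow hα.ne', zero_add, sub_sub_cancel,
      abs_of_nonneg (by positivity)] at e1
    have e2 := mul_le_mul_of_nonneg_left hpow hK.le
    linarith
  have hgb := graph_back_le hK.le hρ hone (xprime p.1) p.2 j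
  have hup : K * (j * ρ) ≤ (1 + K) * h := by
    rw [← hK1]; exact mul_le_mul_of_nonneg_left (hjJ.trans hJ) hK.le
  have hpos : 0 ≤ K * (j * ρ) := by positivity
  rw [smul_smul, CylBH]
  simp only [mem_ofPred_eq, Prod.fst_add, Prod.snd_add, xprime_add_smul_eVec,
    xlast_add_smul_eVec, ← sub_eq_add_neg]
  refine ⟨h1, ht, ?_, ?_, ?_⟩
  · have : 0 ≤ j * ρ ^ 2 := by positivity
    linarith
  · linarith
  · linarith

/-- After `J` steps the shifted point lies above height `h`. -/
lemma le_shift_top (hs : IsGraphSol g r h f w) (hα : 0 < α) (hK : 0 < K) (hρ : 0 < ρ)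
    (hh : ρ ^ α = h) (hhol : HolderSemi α (α / (1 + α)) K g)
    (hone : ∀ (x' : Spc' m) (t s : ℝ), 0 ≤ s →
      -(K * s ^ ((1 : ℝ) / 2)) ≤ g x' (t + s) - g x' t)
    (hJ : J * ρ ≤ (1 / K + 1) * h) (hJ' : h ≤ K * (J * ρ)) (hr : (4 + 3 * K) * h ≤ r)
    {p : Spc m × ℝ} (hp : 0 < negExt g r w p) (ht : -r < p.2 - J * ρ ^ 2) :
    f ≤ w (p + ((J : ℝ) • (2 * K * ρ) • eVec m (Fin.last m), -(J * ρ ^ 2))) := by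
  refine hs.high _ (hs.shift_mem hα hK hρ hh hhol hone hJ hr le_rfl hp ht) ?_
  obtain ⟨⟨-, -, -, h4, -⟩, -⟩ := of_negExt_pos hp
  have hgb := graph_back_le hK.le hρ hone (xprime p.1) p.2 J
  simp only [smul_smul, Prod.fst_add, Prod.snd_add, xprime_add_smul_eVec,
    xlast_add_smul_eVec, ← sub_eq_add_neg]
  linarith

/-- Iterating the decay step. -/
lemma negExt_le_pow (hs : IsGraphSol g r h f w) {c L : ℝ} (hα : 0 < α) (hK : 0 < K) (hρ : 0 < ρ)
    (hh : ρ ^ α = h) (hhol : HolderSemi α (α / (1 + α)) K g)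
    (hone : ∀ (x' : Spc' m) (t s : ℝ), 0 ≤ s →
      -(K * s ^ ((1 : ℝ) / 2)) ≤ g x' (t + s) - g x' t)
    (hJ : J * ρ ≤ (1 / K + 1) * h) (hJ' : h ≤ K * (J * ρ)) (hr : (4 + 3 * K) * h ≤ r)
    (hL : 2 ≤ L) (hc0 : 0 < c) (hc : c ≤ kerConst m (4 + 2 * K))
    (hcL : (4 + 2 * (m + 1)) / L ^ 2 ≤ c / 4) (hf : 1 ≤ f * (c / 2) ^ J)
    (htime : 2 * ρ ^ 2 + J * ρ ^ 2 ≤ r / 4) (k : ℕ) :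
    ∀ p : Spc m × ℝ, (∀ i, |xprime p.1 i| ≤ 3 * r / 4 - k * (L * ρ)) →
      -(3 * r / 4) + k * (2 * ρ ^ 2) ≤ p.2 → p.2 ≤ 0 →
      negExt g r w p ≤ (1 - c ^ 2 / 16) ^ k := by
  have hc1 : c ≤ 1 := hc.trans (kerConst_le_one m _)
  have hη : 0 < 1 - c ^ 2 / 16 := by nlinarith
  have hρ2 := pow_pos hρ 2
  have hLρ : 0 ≤ L * ρ := by positivity
  have hr0 : 0 < r := lt_of_lt_of_le (by
    have : 0 < h := hh ▸ Real.rpow_pos_of_pos hρ α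
    positivity) hr
  induction k with
  | zero => intro p _ _ _; simpa using hs.negExt_le_one p
  | succ k ih =>
    rintro ⟨x, t⟩ hx ht ht0
    push_cast at hx ht
    simp only at hx ht ht0
    have hk : 0 ≤ k * (2 * ρ ^ 2) := by positivity
    have hkL : 0 ≤ k * (L * ρ) := by positivity
    have hlat : ∀ y ∈ Metric.closedBall x (L * ρ), ∀ i,
        |xprime y i| ≤ 3 * r / 4 - k * (L * ρ) := fun y hy i => by
      have e1 := (abs_xprime_sub_le x y i).trans (mem_closedBall_iff_norm.1 hy)
      have e2 := abs_sub_abs_le_abs_sub (xprime y i) (xprime x i)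
      linarith [hx i]
    have htj : ∀ j ≤ J, ∀ p ∈ Metric.closedBall x (L * ρ) ×ˢ Icc (t - 2 * ρ ^ 2) t,
        -r < p.2 - j * ρ ^ 2 := fun j hj p hp => by
      have e1 : (j : ℝ) * ρ ^ 2 ≤ J * ρ ^ 2 := by gcongr
      linarith [hp.2.1]
    rw [pow_succ]
    refine hs.decay_step (ω := (2 * K * ρ) • eVec m (Fin.last m)) hρ (pow_pos hη k) hL hc0 hc ?_
      hcL ?_ ?_ (fun j hj p hp hpos => hs.shift_mem hα hK hρ hh hhol hone hJ hr hj hpos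
        (htj j hj p hp)) (fun p hp hpos => hs.le_shift_top hα hK hρ hh hhol hone hJ hJ' hr hpos
        (htj J le_rfl p hp)) hf
    · rw [norm_smul, norm_eVec, Real.norm_of_nonneg (by positivity)]
      linarith
    · intro p hp
      refine ⟨fun i => abs_lt.1 ?_, ?_, hp.2.2.trans ht0⟩
      · linarith [hlat p.1 hp.1 i]
      · have : 0 ≤ J * ρ ^ 2 := by positivity
        linarith [hp.2.1]
    · exact fun p hp => ih p (hlat p.1 hp.1) (by linarith [hp.2.1]) (hp.2.2.trans ht0)

end IsGraphSol

namespace IsGraphSol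

variable {m : ℕ} {g : Spc' m → ℝ → ℝ} {r h f α K ρ : ℝ} {w : Spc m × ℝ → ℝ} {J : ℕ}

/-- The exponential decay of the negative part in the half cylinder. -/
lemma neg_part_le_exp (hs : IsGraphSol g r h f w) {c L : ℝ} (hα : 0 < α) (hK : 0 < K) (hρ : 0 < ρ)
    (hh : ρ ^ α = h) (hhol : HolderSemi α (α / (1 + α)) K g)
    (hone : ∀ (x' : Spc' m) (t s : ℝ), 0 ≤ s →
      -(K * s ^ ((1 : ℝ) / 2)) ≤ g x' (t + s) - g x' t)
    (hJ : J * ρ ≤ (1 / K + 1) * h) (hJ' : h ≤ K * (J * ρ)) (hr : (4 + 3 * K) * h ≤ r)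
    (hL : 2 ≤ L) (hc0 : 0 < c) (hc : c ≤ kerConst m (4 + 2 * K))
    (hcL : (4 + 2 * (m + 1)) / L ^ 2 ≤ c / 4) (hf : 1 ≤ f * (c / 2) ^ J)
    (htime : 2 * ρ ^ 2 + J * ρ ^ 2 ≤ r / 4) (hρ1 : ρ ≤ 1) (hLr : 8 * (L * ρ) ≤ r)
    {p : Spc m × ℝ} (hp : p ∈ CylBH g (r / 2)) :
    max (-w p) 0 ≤ Real.exp (-(c ^ 2 / (128 * L) * (r / ρ))) := by
  have hL0 : 0 < L := by linarith
  have hLρ : 0 < L * ρ := by positivity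
  have hr0 : 0 < r := by linarith
  obtain ⟨p1, p2, p3, p4, p5⟩ := hp
  have hpr : p ∈ CylBH g r :=
    ⟨fun i => ⟨by linarith [(p1 i).1], by linarith [(p1 i).2]⟩, by linarith, p3, p4, by linarith⟩
  have hc1 : c ≤ 1 := hc.trans (kerConst_le_one m _)
  set k : ℕ := ⌊r / (4 * (L * ρ))⌋₊ with hk
  have hku : k * (L * ρ) ≤ r / 4 := by
    have := Nat.floor_le (show 0 ≤ r / (4 * (L * ρ)) by positivity)
    rw [le_div_iff₀ (by positivity)] at this
    linarith
  have hkl : r / (8 * (L * ρ)) ≤ k := by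
    have e1 := (Nat.lt_floor_add_one (r / (4 * (L * ρ)))).le
    have e2 : 1 ≤ r / (8 * (L * ρ)) := by rwa [one_le_div (by positivity)]
    have e3 : r / (4 * (L * ρ)) = 2 * (r / (8 * (L * ρ))) := by field_simp; norm_num
    linarith
  have hkt : k * (2 * ρ ^ 2) ≤ r / 4 := by
    have e1 : 2 * ρ ^ 2 ≤ L * ρ := by
      rw [pow_two, ← mul_assoc]
      gcongr
      linarith
    exact (mul_le_mul_of_nonneg_left e1 (Nat.cast_nonneg k)).trans hku
  have hmain := hs.negExt_le_pow hα hK hρ hh hhol hone hJ hJ' hr hL hc0 hc hcL hf htime k p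
    (fun i => (abs_lt.2 ⟨by linarith [(p1 i).1], by linarith [(p1 i).2]⟩ :
      |xprime p.1 i| < r / 2).le.trans (by linarith)) (by linarith) p3
  rw [negExt, if_pos hpr] at hmain
  refine hmain.trans ?_
  calc (1 - c ^ 2 / 16) ^ k ≤ Real.exp (-(c ^ 2 / 16)) ^ k :=
        pow_le_pow_left₀ (by nlinarith) (Real.one_sub_le_exp_neg _) k
    _ = Real.exp (-(c ^ 2 / 16 * k)) := by rw [← Real.exp_nat_mul]; congr 1; ring
    _ ≤ _ := by
      rw [Real.exp_le_exp, neg_le_neg_iff]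
      calc c ^ 2 / (128 * L) * (r / ρ) = c ^ 2 / 16 * (r / (8 * (L * ρ))) := by
            field_simp; norm_num
        _ ≤ _ := by gcongr

end IsGraphSol

end NegativePart

/-- **Improved decay of the negative part under a one-sided `C^{1/2}` condition in
time** (estimate (4.2) in the proof of Theorem 1.3). -/
theorem improved_decay_negative_part (m : ℕ) (hm : 1 ≤ m) (K α : ℝ)
    (hK : 0 < K) (hα : 0 < α) (hα1 : α ≤ 1) :
    ∃ β C₀ c r₀ : ℝ, 1 < β ∧ 0 < C₀ ∧ 0 < c ∧ 0 < r₀ ∧ r₀ < 1 ∧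
      ∀ g : Spc' m → ℝ → ℝ,
        Continuous (fun q : Spc' m × ℝ => g q.1 q.2) → g 0 0 = 0 →
        HolderSemi α (α / (1 + α)) K g →
        (∀ (x' : Spc' m) (t s : ℝ), 0 ≤ s → -(K * s ^ ((1 : ℝ) / 2)) ≤ g x' (t + s) - g x' t) →
      ∀ r : ℝ, 0 < r → r ≤ r₀ →
      ∀ w : Spc m × ℝ → ℝ,
        SolvesHeat w (CylBH g r) →
        VanishesOn (fun q => max (-w q) 0) (CylBH g r) (graphSet g) →
        (∀ p ∈ ASetH g β r, Real.exp (C₀ * r ^ (β * (1 - 1 / α))) ≤ w p) →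
        (∀ p ∈ CylBH g r, -1 ≤ w p) →
        ∀ p ∈ CylBH g (r / 2), max (-w p) 0 ≤ Real.exp (-(c * r ^ (1 - β / α))) := by
  set c := kerConst m (4 + 2 * K) with hc
  have hc0 : 0 < c := kerConst_pos _ _
  have hc1 : c ≤ 1 := kerConst_le_one _ _
  set A : ℝ := 1 / K + 1 with hA
  have hA1 : 1 < A := by have : 0 < 1 / K := by positivity
                         linarith
  set L : ℝ := 4 * (4 + 2 * (m + 1)) / c with hL
  have hL16 : 16 ≤ L := by
    rw [hL, le_div_iff₀ hc0]
    have : (0 : ℝ) ≤ m := by positivity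
    nlinarith
  have hcL : (4 + 2 * ((m : ℝ) + 1)) / L ^ 2 ≤ c / 4 := by
    have : 4 + 2 * ((m : ℝ) + 1) = L * c / 4 := by rw [hL]; field_simp
    rw [this, div_le_iff₀ (by positivity)]
    nlinarith [mul_nonneg hc0.le (show 0 ≤ L * (L - 1) from mul_nonneg (by linarith) (by linarith))]
  have hlog : 0 < -Real.log (c / 2) := by
    have := Real.log_neg (by positivity) (show c / 2 < 1 by linarith)
    linarith
  set r₀ : ℝ := min (1 / 2) (min (1 / (4 + 3 * K)) (min (1 / (4 * (2 + A))) (1 / (8 * L)))) with hr₀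
  have hr₀pos : 0 < r₀ := by
    simp only [hr₀, lt_min_iff]
    refine ⟨by norm_num, by positivity, by positivity, by positivity⟩
  refine ⟨2, A * -Real.log (c / 2), c ^ 2 / (128 * L), r₀, by norm_num, by positivity,
    by positivity, hr₀pos, lt_of_le_of_lt (min_le_left _ _) (by norm_num), ?_⟩
  intro g hg _ hhol hone r hr0 hrr w hheat hvan hhigh hlow p hp
  simp only [hr₀, le_min_iff] at hrr
  obtain ⟨hr1, hr2, hr3, hr4⟩ := hrr
  rw [le_div_iff₀ (by positivity)] at hr2 hr3 hr4
  set ρ : ℝ := r ^ (2 / α) with hρdef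
  have hρ : 0 < ρ := Real.rpow_pos_of_pos hr0 _
  have hh : ρ ^ α = r ^ 2 := by
    rw [hρdef, ← Real.rpow_mul hr0.le, div_mul_cancel₀ _ hα.ne', Real.rpow_two]
  have hρh : ρ ≤ r ^ 2 := by
    rw [← Real.rpow_two]
    exact Real.rpow_le_rpow_of_exponent_ge hr0 (by linarith)
      (by rw [le_div_iff₀ hα]; linarith)
  have hhρ : r ^ ((2 : ℝ) * (1 - 1 / α)) = r ^ 2 / ρ := by
    rw [show (2 : ℝ) * (1 - 1 / α) = 2 - 2 / α by ring, Real.rpow_sub hr0, Real.rpow_two]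
  have hrρ : r ^ (1 - 2 / α) = r / ρ := by rw [Real.rpow_sub hr0, Real.rpow_one]
  have hh1 : r ^ 2 ≤ 1 := by nlinarith
  have hr2' : r ^ 2 * 2 ≤ r := by nlinarith
  set J : ℕ := ⌈r ^ 2 / (K * ρ)⌉₊ with hJdef
  have hJl : r ^ 2 ≤ K * (J * ρ) := by
    have := Nat.le_ceil (r ^ 2 / (K * ρ))
    rw [div_le_iff₀ (by positivity)] at this
    linarith
  have hJu : (J : ℝ) * ρ ≤ A * r ^ 2 := by
    have := (Nat.ceil_lt_add_one (show 0 ≤ r ^ 2 / (K * ρ) by positivity)).le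
    calc (J : ℝ) * ρ ≤ (r ^ 2 / (K * ρ) + 1) * ρ := by gcongr
      _ = 1 / K * r ^ 2 + ρ := by field_simp
      _ ≤ A * r ^ 2 := by rw [hA]; linarith
  have hs : IsGraphSol g r (r ^ 2) (Real.exp (A * -Real.log (c / 2) * (r ^ 2 / ρ))) w :=
    { cont := hg
      lt := by nlinarith
      f_pos := Real.exp_pos _
      heat := hheat
      vanish := hvan
      high := fun q hq hq2 => by
        rw [← hhρ]; exact hhigh q ⟨hq, by rw [Real.rpow_two]; exact hq2⟩
      low := hlow }
  have hf : 1 ≤ Real.exp (A * -Real.log (c / 2) * (r ^ 2 / ρ)) * (c / 2) ^ J := by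
    rw [← Real.exp_log (show 0 < c / 2 by positivity), ← Real.exp_nat_mul, Real.log_exp,
      ← Real.exp_add, Real.one_le_exp_iff]
    have h1 : (J : ℝ) ≤ A * (r ^ 2 / ρ) := by
      rw [← mul_div_assoc, le_div_iff₀ hρ]; exact hJu
    have h2 := mul_le_mul_of_nonneg_right h1 hlog.le
    linarith
  have htime : 2 * ρ ^ 2 + J * ρ ^ 2 ≤ r / 4 := by
    have e1 : ρ * ρ ≤ r ^ 2 * 1 := mul_le_mul hρh (hρh.trans hh1) hρ.le (by positivity)
    have e2 : J * ρ * ρ ≤ A * r ^ 2 * 1 :=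
      mul_le_mul hJu (hρh.trans hh1) hρ.le (by positivity)
    have e3 := mul_le_mul_of_nonneg_right hr3 hr0.le
    linarith
  rw [hrρ]
  refine hs.neg_part_le_exp hα hK hρ hh hhol hone hJu hJl ?_ (by linarith) hc0 le_rfl hcL hf htime
    (hρh.trans hh1) ?_ hp
  · calc (4 + 3 * K) * r ^ 2 = r * (4 + 3 * K) * r := by ring
      _ ≤ 1 * r := by gcongr
      _ = r := one_mul r
  · calc 8 * (L * ρ) ≤ 8 * (L * r ^ 2) := by gcongr
      _ = r * (8 * L) * r := by ring
      _ ≤ 1 * r := by gcongr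
      _ = r := one_mul r
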